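/- arXiv:math/9808134 — 3 statements merged into one kernel-verified Lean document; each statement's English description precedes it below -/
import Mathlib

section
/- Let U be an open neighborhood of 0 in ℝ³ and let Φ : U ∖ {0} → ℝ be a nonnegative harmonic function. Then there exist a constant c ≥ 0 and a harmonic function φ : U → ℝ such that Φ(x) = c/|x| + φ(x) for all x ∈ U ∖ {0}. -/
open scoped BigOperators

/-- The Laplacian of `f : ℝ³ → ℝ` at a point, computed as the sum of the second
directional derivatives along the standard orthonormal basis. -/
noncomputable def laplacian3 (f : EuclideanSpace ℝ (Fin 3) → ℝ)
    (x : EuclideanSpace ℝ (Fin 3)) : ℝ :=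
  ∑ i : Fin 3,
    fderiv ℝ (fun y => fderiv ℝ f y (EuclideanSpace.single i 1)) x (EuclideanSpace.single i 1)

/-- `f` is harmonic on `s`: it is `C²` there and its Laplacian vanishes on `s`. -/
def HarmonicOn3 (f : EuclideanSpace ℝ (Fin 3) → ℝ) (s : Set (EuclideanSpace ℝ (Fin 3))) : Prop :=
  ContDiffOn ℝ 2 f s ∧ ∀ x ∈ s, laplacian3 f x = 0

open Filter Topology MeasureTheory Metric
open scoped ContDiff

/-- Euclidean three-space. -/
abbrev E3 : Type := EuclideanSpace ℝ (Fin 3)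

/-- The `i`-th partial derivative of a function on three-space. -/
noncomputable def partialD (i : Fin 3) (f : E3 → ℝ) (x : E3) : ℝ :=
  fderiv ℝ f x (EuclideanSpace.single i 1)

theorem laplacian3_eq_sum (f : E3 → ℝ) (x : E3) :
    laplacian3 f x = ∑ i, partialD i (partialD i f) x := rfl

section Calculus

variable {f g : E3 → ℝ} {x : E3} {i : Fin 3}

theorem Filter.EventuallyEq.partialD (h : f =ᶠ[𝓝 x] g) :
    partialD i f =ᶠ[𝓝 x] partialD i g :=
  h.fderiv.mono fun y hy => by rw [_root_.partialD, _root_.partialD, hy]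

theorem Filter.EventuallyEq.laplacian3 (h : f =ᶠ[𝓝 x] g) :
    laplacian3 f x = laplacian3 g x := by
  simp only [laplacian3_eq_sum]
  exact Finset.sum_congr rfl fun i _ => h.partialD.partialD.eq_of_nhds

theorem ContDiffAt.partialD {n m : ℕ∞ω} (hf : ContDiffAt ℝ n f x) (hmn : m + 1 ≤ n) :
    ContDiffAt ℝ m (partialD i f) x :=
  (hf.fderiv_right hmn).clm_apply contDiffAt_const

theorem ContDiff.partialD {n m : ℕ∞ω} (hf : ContDiff ℝ n f) (hmn : m + 1 ≤ n) :
    ContDiff ℝ m (partialD i f) :=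
  (hf.fderiv_right hmn).clm_apply contDiff_const

theorem ContDiff.continuous_laplacian3 (hf : ContDiff ℝ 2 f) : Continuous (laplacian3 f) := by
  have h : ∀ i, Continuous (_root_.partialD i (_root_.partialD i f)) := fun i =>
    ((hf.partialD (m := 1) (by norm_num)).partialD (m := 0) (by norm_num)).continuous
  exact continuous_finsetSum _ fun i _ => h i

theorem partialD_const (c : ℝ) : partialD i (fun _ => c) x = 0 := by
  simp [partialD]

theorem laplacian3_const (c : ℝ) : laplacian3 (fun _ => c) x = 0 := by
  have : ∀ i, partialD i (fun _ : E3 => c) = fun _ => 0 := fun i => by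
    ext y; exact partialD_const c
  simp [laplacian3_eq_sum, this, partialD_const]

theorem partialD_sub (hf : DifferentiableAt ℝ f x) (hg : DifferentiableAt ℝ g x) :
    partialD i (fun y => f y - g y) x = partialD i f x - partialD i g x := by
  simp [partialD, fderiv_fun_sub hf hg]

theorem partialD_add (hf : DifferentiableAt ℝ f x) (hg : DifferentiableAt ℝ g x) :
    partialD i (fun y => f y + g y) x = partialD i f x + partialD i g x := by
  simp [partialD, fderiv_fun_add hf hg]

theorem partialD_mul (hf : DifferentiableAt ℝ f x) (hg : DifferentiableAt ℝ g x) :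
    partialD i (fun y => f y * g y) x = f x * partialD i g x + g x * partialD i f x := by
  simp [partialD, fderiv_fun_mul hf hg]

theorem ContDiffAt.eventually_differentiableAt (hf : ContDiffAt ℝ 2 f x) :
    ∀ᶠ y in 𝓝 x, DifferentiableAt ℝ f y :=
  (hf.eventually (by simp)).mono fun _ hy => hy.differentiableAt (by norm_num)

theorem ContDiffAt.differentiableAt_partialD (hf : ContDiffAt ℝ 2 f x) :
    DifferentiableAt ℝ (_root_.partialD i f) x :=
  (hf.partialD (m := 1) (by norm_num)).differentiableAt (by norm_num)

theorem laplacian3_sub (hf : ContDiffAt ℝ 2 f x) (hg : ContDiffAt ℝ 2 g x) :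
    laplacian3 (fun y => f y - g y) x = laplacian3 f x - laplacian3 g x := by
  simp only [laplacian3_eq_sum, ← Finset.sum_sub_distrib]
  refine Finset.sum_congr rfl fun i _ => ?_
  rw [← partialD_sub hf.differentiableAt_partialD hg.differentiableAt_partialD]
  refine (EventuallyEq.partialD ?_).eq_of_nhds
  filter_upwards [hf.eventually_differentiableAt, hg.eventually_differentiableAt] with y h1 h2
  exact partialD_sub h1 h2

theorem laplacian3_mul (hf : ContDiffAt ℝ 2 f x) (hg : ContDiffAt ℝ 2 g x) :
    laplacian3 (fun y => f y * g y) x =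
      f x * laplacian3 g x + 2 * ∑ i, partialD i f x * partialD i g x + g x * laplacian3 f x := by
  simp only [laplacian3_eq_sum, Finset.mul_sum, ← Finset.sum_add_distrib]
  refine Finset.sum_congr rfl fun i _ => ?_
  have h : partialD i (fun y => f y * g y) =ᶠ[𝓝 x]
      fun y => f y * partialD i g y + g y * partialD i f y := by
    filter_upwards [hf.eventually_differentiableAt, hg.eventually_differentiableAt] with y h1 h2
    exact partialD_mul h1 h2
  have hf1 := hf.differentiableAt (by norm_num)
  have hg1 := hg.differentiableAt (by norm_num)
  have hf2 : DifferentiableAt ℝ (partialD i f) x := hf.differentiableAt_partialD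
  have hg2 : DifferentiableAt ℝ (partialD i g) x := hg.differentiableAt_partialD
  rw [h.partialD.eq_of_nhds, partialD_add (hf1.fun_mul hg2) (hg1.fun_mul hf2),
    partialD_mul hf1 hg2, partialD_mul hg1 hf2]
  ring

theorem partialD_comp {G : ℝ → ℝ} (hG : DifferentiableAt ℝ G (f x))
    (hf : DifferentiableAt ℝ f x) :
    partialD i (fun y => G (f y)) x = deriv G (f x) * partialD i f x := by
  have := (hG.hasDerivAt.comp_hasFDerivAt x hf.hasFDerivAt).fderiv
  simp only [partialD]
  rw [show (fun y => G (f y)) = G ∘ f from rfl, this]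
  simp

theorem laplacian3_comp {G : ℝ → ℝ} (hG : ContDiff ℝ 2 G) (hf : ContDiffAt ℝ 2 f x) :
    laplacian3 (fun y => G (f y)) x =
      deriv (deriv G) (f x) * ∑ i, partialD i f x ^ 2 + deriv G (f x) * laplacian3 f x := by
  have hG' : ContDiff ℝ 1 (deriv G) := (contDiff_succ_iff_deriv (n := 1).1 hG).2.2
  simp only [laplacian3_eq_sum, Finset.mul_sum, ← Finset.sum_add_distrib]
  refine Finset.sum_congr rfl fun i _ => ?_
  have h : partialD i (fun y => G (f y)) =ᶠ[𝓝 x] fun y => deriv G (f y) * partialD i f y := by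
    filter_upwards [hf.eventually_differentiableAt] with y h1
    exact partialD_comp (hG.differentiable (by norm_num) _) h1
  have hf1 := hf.differentiableAt (by norm_num)
  have hf2 : DifferentiableAt ℝ (partialD i f) x := hf.differentiableAt_partialD
  have hG1 : DifferentiableAt ℝ (deriv G) (f x) := hG'.differentiable (by norm_num) _
  have hGf : DifferentiableAt ℝ (fun y => deriv G (f y)) x := hG1.comp x hf1
  rw [h.partialD.eq_of_nhds, partialD_mul hGf hf2,
    partialD_comp hG1 hf1]
  ring

theorem laplacian3_const_mul (c : ℝ) (hf : ContDiffAt ℝ 2 f x) :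
    laplacian3 (fun y => c * f y) x = c * laplacian3 f x := by
  rw [laplacian3_mul contDiffAt_const hf, laplacian3_const]
  simp [partialD_const]

theorem partialD_const_mul (c : ℝ) :
    partialD i (fun y => c * f y) x = c * partialD i f x := by
  have : (fun y => c * f y) = c • f := rfl
  simp [partialD, this, fderiv_const_smul_field]

theorem partialD_comp_const_sub (a : E3) :
    partialD i (fun y => f (a - y)) x = - partialD i f (a - x) := by
  have h : (fun y => f (a - y)) = fun y => (fun z => f (-z)) (y - a) := by ext; simp
  simp only [partialD]
  rw [h, fderiv_comp_sub (f := fun z => f (-z)) a]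
  have := fderiv_comp_smul (𝕜 := ℝ) (f := f) (x := x - a) (-1)
  simp only [neg_smul, one_smul] at this
  rw [this]
  simp

theorem laplacian3_comp_const_sub (a : E3) :
    laplacian3 (fun y => f (a - y)) x = laplacian3 f (a - x) := by
  simp only [laplacian3_eq_sum]
  refine Finset.sum_congr rfl fun i _ => ?_
  have h : partialD i (fun y => f (a - y)) = fun y => (-1) * partialD i f (a - y) := by
    ext y; rw [partialD_comp_const_sub]; ring
  rw [h, partialD_const_mul, partialD_comp_const_sub]
  ring

theorem partialD_comp_smul (c : ℝ) :
    partialD i (fun y => f (c • y)) x = c * partialD i f (c • x) := by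
  simp [partialD, fderiv_comp_smul]

theorem laplacian3_comp_smul (c : ℝ) :
    laplacian3 (fun y => f (c • y)) x = c ^ 2 * laplacian3 f (c • x) := by
  simp only [laplacian3_eq_sum, Finset.mul_sum]
  refine Finset.sum_congr rfl fun i _ => ?_
  have h : partialD i (fun y => f (c • y)) = fun y => c * partialD i f (c • y) := by
    ext y; rw [partialD_comp_smul]
  rw [h, partialD_const_mul, partialD_comp_smul]
  ring

theorem abs_partialD_le : |partialD i f x| ≤ ‖fderiv ℝ f x‖ := by
  simpa [partialD] using (fderiv ℝ f x).le_opNorm (EuclideanSpace.single i (1 : ℝ))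

end Calculus

section InverseNorm

variable {x : E3}

theorem contDiffAt_inv_norm {n : ℕ∞ω} (hx : x ≠ 0) : ContDiffAt ℝ n (fun y : E3 => ‖y‖⁻¹) x :=
  (contDiffAt_norm ℝ hx).inv (by simpa using hx)

theorem partialD_inv_norm (hx : x ≠ 0) (i : Fin 3) :
    partialD i (fun y : E3 => ‖y‖⁻¹) x = - (‖x‖⁻¹ ^ 3 * x i) := by
  have hn : ‖x‖ ≠ 0 := by simpa using hx
  have h1 : HasFDerivAt (fun y : E3 => ‖y‖ ^ 2) (2 • (innerSL ℝ) x) x :=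
    (hasStrictFDerivAt_norm_sq x).hasFDerivAt
  have h2 : DifferentiableAt ℝ (fun y : E3 => ‖y‖) x :=
    (contDiffAt_norm (n := 1) ℝ hx).differentiableAt (by norm_num)
  have h3 : partialD i (fun y : E3 => ‖y‖ ^ 2) x = 2 * x i := by
    simp [partialD, h1.fderiv, innerSL_apply_apply, EuclideanSpace.inner_single_right]
  have h4 : partialD i (fun y : E3 => ‖y‖ ^ 2) x = 2 * ‖x‖ * partialD i (fun y : E3 => ‖y‖) x := by
    rw [partialD_comp (G := fun s => s ^ 2) (by fun_prop) h2]
    simp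
  rw [partialD_comp (G := fun s => s⁻¹) (differentiableAt_inv hn) h2, deriv_inv]
  have h5 : partialD i (fun y : E3 => ‖y‖) x = x i / ‖x‖ := by
    field_simp; linarith
  rw [h5]
  field_simp

theorem sum_sq_partialD_inv_norm (hx : x ≠ 0) :
    ∑ i, partialD i (fun y : E3 => ‖y‖⁻¹) x ^ 2 = ‖x‖⁻¹ ^ 4 := by
  have hn : ‖x‖ ≠ 0 := by simpa using hx
  have h := EuclideanSpace.real_norm_sq_eq x
  simp only [partialD_inv_norm hx, neg_sq, mul_pow, ← Finset.mul_sum, ← h]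
  field_simp

theorem laplacian3_inv_norm (hx : x ≠ 0) : laplacian3 (fun y : E3 => ‖y‖⁻¹) x = 0 := by
  have hn : ‖x‖ ≠ 0 := by simpa using hx
  have hd : DifferentiableAt ℝ (fun y : E3 => ‖y‖⁻¹) x :=
    (contDiffAt_inv_norm (n := 1) hx).differentiableAt (by norm_num)
  have key : ∀ i, partialD i (partialD i (fun y : E3 => ‖y‖⁻¹)) x =
      3 * ‖x‖⁻¹ ^ 5 * x i ^ 2 - ‖x‖⁻¹ ^ 3 := by
    intro i
    have h : partialD i (fun y : E3 => ‖y‖⁻¹) =ᶠ[𝓝 x] fun y => (-1) * (‖y‖⁻¹ ^ 3 * y i) := by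
      filter_upwards [isOpen_ne.mem_nhds hx] with y hy
      rw [partialD_inv_norm hy]; ring
    have hc : partialD i (fun y : E3 => y i) x = 1 := by
      have : (fun y : E3 => y i) = EuclideanSpace.proj (𝕜 := ℝ) i := rfl
      rw [partialD, this, ContinuousLinearMap.fderiv]
      simp
    rw [h.partialD.eq_of_nhds, partialD_const_mul, partialD_mul (hd.fun_pow 3) (by fun_prop), hc,
      partialD_comp (G := fun s => s ^ 3) (by fun_prop) hd, partialD_inv_norm hx, deriv_pow_field]
    push_cast
    ring
  simp only [laplacian3_eq_sum, key, Finset.sum_sub_distrib, ← Finset.mul_sum]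
  rw [← EuclideanSpace.real_norm_sq_eq x, Finset.sum_const, Finset.card_univ, Fintype.card_fin]
  simp only [nsmul_eq_mul]
  field_simp
  norm_num

end InverseNorm

section WeakHarmonicity

variable {U : Set E3} {Φ T p : E3 → ℝ} {a R : ℝ}

/-- `p` vanishes outside the closed annulus of radii `a` and `R` about the origin. -/
def VanishesOffAnnulus (p : E3 → ℝ) (a R : ℝ) : Prop :=
  (∀ y, ‖y‖ < a → p y = 0) ∧ ∀ y, R < ‖y‖ → p y = 0

theorem VanishesOffAnnulus.eventuallyEq_zero (hp : VanishesOffAnnulus p a R) {y : E3}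
    (hy : ‖y‖ < a ∨ R < ‖y‖) : p =ᶠ[𝓝 y] fun _ => 0 := by
  rcases hy with hy | hy
  · filter_upwards [(isOpen_lt continuous_norm continuous_const).mem_nhds hy] with z hz
    exact hp.1 z hz
  · filter_upwards [(isOpen_lt continuous_const continuous_norm).mem_nhds hy] with z hz
    exact hp.2 z hz

theorem VanishesOffAnnulus.mul_right (hp : VanishesOffAnnulus p a R) (q : E3 → ℝ) :
    VanishesOffAnnulus (fun y => p y * q y) a R :=
  ⟨fun y hy => by simp [hp.1 y hy], fun y hy => by simp [hp.2 y hy]⟩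

theorem VanishesOffAnnulus.mul_left (hp : VanishesOffAnnulus p a R) (q : E3 → ℝ) :
    VanishesOffAnnulus (fun y => q y * p y) a R :=
  ⟨fun y hy => by simp [hp.1 y hy], fun y hy => by simp [hp.2 y hy]⟩

theorem VanishesOffAnnulus.partialD (hp : VanishesOffAnnulus p a R) (i : Fin 3) :
    VanishesOffAnnulus (partialD i p) a R := by
  constructor <;> intro y hy
  · rw [(hp.eventuallyEq_zero (Or.inl hy)).partialD.eq_of_nhds, partialD_const]
  · rw [(hp.eventuallyEq_zero (Or.inr hy)).partialD.eq_of_nhds, partialD_const]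

theorem VanishesOffAnnulus.hasCompactSupport (hp : VanishesOffAnnulus p a R) :
    HasCompactSupport p :=
  HasCompactSupport.intro (isCompact_closedBall 0 R) fun y hy => hp.2 y (by simpa using hy)

theorem mem_diff_singleton_of_annulus (ha : 0 < a) (hR : closedBall 0 R ⊆ U) {y : E3}
    (hy : ¬ (‖y‖ < a ∨ R < ‖y‖)) : y ∈ U \ {0} := by
  push Not at hy
  refine ⟨hR (by simpa using hy.2), ?_⟩
  rintro rfl
  simp at hy
  linarith [hy.1]

theorem VanishesOffAnnulus.contDiff_mul {n : ℕ∞ω} (hU : IsOpen U) (ha : 0 < a)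
    (hR : closedBall 0 R ⊆ U) (hΦ : ContDiffOn ℝ n Φ (U \ {0})) (hp : ContDiff ℝ n p)
    (hpa : VanishesOffAnnulus p a R) : ContDiff ℝ n fun y => Φ y * p y := by
  have hV : IsOpen (U \ {0}) := hU.sdiff isClosed_singleton
  rw [contDiff_iff_contDiffAt]
  intro y
  by_cases hy : ‖y‖ < a ∨ R < ‖y‖
  · exact contDiffAt_const.congr_of_eventuallyEq ((hpa.mul_left Φ).eventuallyEq_zero hy)
  · exact (hΦ.contDiffAt (hV.mem_nhds (mem_diff_singleton_of_annulus ha hR hy))).mul hp.contDiffAt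

theorem VanishesOffAnnulus.continuous_mul (hU : IsOpen U) (ha : 0 < a)
    (hR : closedBall 0 R ⊆ U) (hΦ : ContinuousOn Φ (U \ {0})) (hp : Continuous p)
    (hpa : VanishesOffAnnulus p a R) : Continuous fun y => Φ y * p y :=
  (hpa.contDiff_mul hU ha hR (contDiffOn_zero.2 hΦ) (contDiff_zero.2 hp)).continuous

theorem VanishesOffAnnulus.integrable_mul (hU : IsOpen U) (ha : 0 < a)
    (hR : closedBall 0 R ⊆ U) (hΦ : ContinuousOn Φ (U \ {0})) (hp : Continuous p)
    (hpa : VanishesOffAnnulus p a R) : Integrable fun y => Φ y * p y :=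
  (hpa.continuous_mul hU ha hR hΦ hp).integrable_of_hasCompactSupport
    (hpa.mul_left Φ).hasCompactSupport

theorem integral_partialD_eq_zero {f : E3 → ℝ} (hf : ContDiff ℝ 1 f) (hc : HasCompactSupport f)
    (i : Fin 3) : Integrable (partialD i f) ∧ ∫ y, partialD i f y = 0 := by
  have hi : Integrable (partialD i f) :=
    (hf.partialD (m := 0) (by norm_num)).continuous.integrable_of_hasCompactSupport
      ((hc.fderiv (𝕜 := ℝ)).comp_left (g := fun L : E3 →L[ℝ] ℝ => L (EuclideanSpace.single i 1))
        (by simp))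
  refine ⟨hi, ?_⟩
  have h := integral_mul_fderiv_eq_neg_fderiv_mul_of_integrable (μ := (volume : Measure E3))
    (f := f) (g := fun _ => (1 : ℝ)) (v := EuclideanSpace.single i 1)
    (by simpa only [mul_one] using! hi) (by simp)
    (by simpa using hf.continuous.integrable_of_hasCompactSupport hc)
    (fun x _ => hf.differentiable (by norm_num) x) (fun x _ => by fun_prop)
  simp only [mul_one, fderiv_fun_const, Pi.zero_apply, _root_.zero_apply,
    mul_zero, integral_zero] at h
  simpa [partialD] using h.symm

/-- Harmonic functions are weakly harmonic: they annihilate Laplacians of test functions. -/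
theorem HarmonicOn3.integral_mul_laplacian3_eq_zero (hU : IsOpen U)
    (hΦ : HarmonicOn3 Φ (U \ {0})) (ha : 0 < a) (hR : closedBall 0 R ⊆ U)
    (hT : ContDiff ℝ 2 T) (hTa : VanishesOffAnnulus T a R) :
    ∫ y, Φ y * laplacian3 T y = 0 := by
  have hV : IsOpen (U \ {0}) := hU.sdiff isClosed_singleton
  have hT1 : ∀ i, ContDiff ℝ 1 (partialD i T) := fun i => hT.partialD (by norm_num)
  let V : Fin 3 → E3 → ℝ := fun i y => Φ y * partialD i T y - partialD i Φ y * T y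
  have hΦ1 : ∀ i, ContDiffOn ℝ 1 (partialD i Φ) (U \ {0}) := fun i y hy =>
    ((hΦ.1.contDiffAt (hV.mem_nhds hy)).partialD (by norm_num)).contDiffWithinAt
  have hVc : ∀ i, ContDiff ℝ 1 (V i) := fun i =>
    ((hTa.partialD i).contDiff_mul hU ha hR (hΦ.1.of_le (by norm_num)) (hT1 i)).sub
      (hTa.contDiff_mul hU ha hR (hΦ1 i) (hT.of_le (by norm_num)))
  have hVa : ∀ i, VanishesOffAnnulus (V i) a R := fun i =>
    ⟨fun y hy => by simp [V, hTa.1 y hy, (hTa.partialD i).1 y hy],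
      fun y hy => by simp [V, hTa.2 y hy, (hTa.partialD i).2 y hy]⟩
  have hVi := fun i => integral_partialD_eq_zero (hVc i) (hVa i).hasCompactSupport i
  have key : ∀ y, Φ y * laplacian3 T y = ∑ i, partialD i (V i) y := by
    intro y
    by_cases hy : ‖y‖ < a ∨ R < ‖y‖
    · have h0 : ∀ i, partialD i (V i) y = 0 := fun i => by
        rw [((hVa i).eventuallyEq_zero hy).partialD.eq_of_nhds, partialD_const]
      have h1 : laplacian3 T y = 0 := by
        rw [(hTa.eventuallyEq_zero hy).laplacian3, laplacian3_const]
      simp [h0, h1]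
    · have hyV := mem_diff_singleton_of_annulus ha hR hy
      have hΦy := hΦ.1.contDiffAt (hV.mem_nhds hyV)
      have hd : DifferentiableAt ℝ Φ y := hΦy.differentiableAt (by norm_num)
      have hTd : DifferentiableAt ℝ T y := hT.differentiable (by norm_num) y
      have hd1 : ∀ i, DifferentiableAt ℝ (partialD i Φ) y := fun i => hΦy.differentiableAt_partialD
      have hTd1 : ∀ i, DifferentiableAt ℝ (partialD i T) y := fun i =>
        (hT1 i).differentiable (by norm_num) y
      have h1 : ∀ i, partialD i (V i) y =
          Φ y * partialD i (partialD i T) y - T y * partialD i (partialD i Φ) y := by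
        intro i
        rw [partialD_sub (hd.fun_mul (hTd1 i)) ((hd1 i).fun_mul hTd), partialD_mul hd (hTd1 i),
          partialD_mul (hd1 i) hTd]
        ring
      simp only [h1, Finset.sum_sub_distrib, ← Finset.mul_sum, ← laplacian3_eq_sum, hΦ.2 y hyV]
      ring
  simp only [key]
  rw [integral_finsetSum _ fun i _ => (hVi i).1]
  exact Finset.sum_eq_zero fun i _ => (hVi i).2

end WeakHarmonicity

section Kernel

/-- A smooth bump supported in `(1, 2)`. -/
noncomputable def profileBump : ContDiffBump (3 / 2 : ℝ) := ⟨1 / 4, 1 / 2, by norm_num, by norm_num⟩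

theorem profileBump_of_le {s : ℝ} (hs : s ≤ 1) : profileBump s = 0 :=
  profileBump.zero_of_le_dist (by
    rw [Real.dist_eq, abs_of_nonpos (by linarith)]; simp [profileBump]; linarith)

theorem profileBump_of_ge {s : ℝ} (hs : 2 ≤ s) : profileBump s = 0 :=
  profileBump.zero_of_le_dist (by
    rw [Real.dist_eq, abs_of_nonneg (by linarith)]; simp [profileBump]; linarith)

theorem profileBump_eq_one {s : ℝ} (h1 : 5 / 4 ≤ s) (h2 : s ≤ 7 / 4) : profileBump s = 1 :=
  profileBump.one_of_mem_closedBall (by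
    rw [mem_closedBall, Real.dist_eq, abs_le]; simp [profileBump]; constructor <;> linarith)

/-- The total mass of `profileBump`. -/
noncomputable def profileSlope : ℝ := ∫ t in (1 : ℝ)..2, profileBump t

/-- The derivative of `profile`. -/
noncomputable def profileDeriv (s : ℝ) : ℝ := profileSlope - ∫ t in (1 : ℝ)..s, profileBump t

/-- A smooth concave function, linear on `[0, 1]` and constant on `[2, ∞)`. -/
noncomputable def profile (s : ℝ) : ℝ := ∫ t in (0 : ℝ)..s, profileDeriv t

theorem hasDerivAt_profileDeriv (s : ℝ) : HasDerivAt profileDeriv (-profileBump s) s := by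
  have h : Continuous profileBump := profileBump.continuous
  exact (intervalIntegral.integral_hasDerivAt_right (h.intervalIntegrable _ _)
    (h.stronglyMeasurableAtFilter _ _) h.continuousAt).const_sub _

theorem deriv_profileDeriv : deriv profileDeriv = fun s => -profileBump s :=
  funext fun s => (hasDerivAt_profileDeriv s).deriv

theorem contDiff_profileDeriv : ContDiff ℝ ∞ profileDeriv := by
  rw [contDiff_infty_iff_deriv, deriv_profileDeriv]
  exact ⟨fun s => (hasDerivAt_profileDeriv s).differentiableAt, profileBump.contDiff.neg⟩

theorem hasDerivAt_profile (s : ℝ) : HasDerivAt profile (profileDeriv s) s := by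
  have h : Continuous profileDeriv := contDiff_profileDeriv.continuous
  exact intervalIntegral.integral_hasDerivAt_right (h.intervalIntegrable _ _)
    (h.stronglyMeasurableAtFilter _ _) h.continuousAt

theorem deriv_profile : deriv profile = profileDeriv :=
  funext fun s => (hasDerivAt_profile s).deriv

theorem contDiff_profile : ContDiff ℝ ∞ profile := by
  rw [contDiff_infty_iff_deriv, deriv_profile]
  exact ⟨fun s => (hasDerivAt_profile s).differentiableAt, contDiff_profileDeriv⟩

theorem profileDeriv_of_le {s : ℝ} (hs : s ≤ 1) : profileDeriv s = profileSlope := by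
  have : ∫ t in (1 : ℝ)..s, profileBump t = ∫ t in (1 : ℝ)..s, (0 : ℝ) :=
    intervalIntegral.integral_congr fun t ht => by
      rw [Set.uIcc_of_ge hs] at ht
      exact profileBump_of_le ht.2
  simp [profileDeriv, this]

theorem profileDeriv_of_ge {s : ℝ} (hs : 2 ≤ s) : profileDeriv s = 0 := by
  have h : Continuous profileBump := profileBump.continuous
  have : ∫ t in (2 : ℝ)..s, profileBump t = ∫ t in (2 : ℝ)..s, (0 : ℝ) :=
    intervalIntegral.integral_congr fun t ht => by
      rw [Set.uIcc_of_le hs] at ht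
      exact profileBump_of_ge ht.1
  rw [profileDeriv, ← intervalIntegral.integral_add_adjacent_intervals
    (h.intervalIntegrable 1 2) (h.intervalIntegrable 2 s), this, profileSlope]
  simp

theorem profile_of_le {s : ℝ} (hs : s ≤ 1) : profile s = profileSlope * s := by
  have : ∫ t in (0 : ℝ)..s, profileDeriv t = ∫ t in (0 : ℝ)..s, profileSlope :=
    intervalIntegral.integral_congr fun t ht => by
      refine profileDeriv_of_le ?_
      rcases Set.mem_uIcc.1 ht with h | h <;> linarith [h.2]
  simp [profile, this, mul_comm]

theorem profile_of_ge {s : ℝ} (hs : 2 ≤ s) : profile s = profile 2 := by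
  have h : Continuous profileDeriv := contDiff_profileDeriv.continuous
  have : ∫ t in (2 : ℝ)..s, profileDeriv t = ∫ t in (2 : ℝ)..s, (0 : ℝ) :=
    intervalIntegral.integral_congr fun t ht => by
      rw [Set.uIcc_of_le hs] at ht
      exact profileDeriv_of_ge ht.1
  rw [profile, ← intervalIntegral.integral_add_adjacent_intervals
    (h.intervalIntegrable 0 2) (h.intervalIntegrable 2 s), this, profile]
  simp

/-- A smooth superharmonic truncation of the Newtonian kernel `profileSlope / ‖z‖`, unchanged for
`δ ≤ ‖z‖` and constant for `‖z‖ ≤ δ / 2`. -/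
noncomputable def newtonKernel (δ : ℝ) (z : E3) : ℝ :=
  δ⁻¹ * if z = 0 then profile 2 else profile (δ * ‖z‖⁻¹)

/-- Minus the Laplacian of `newtonKernel δ`. -/
noncomputable def newtonMass (δ : ℝ) (z : E3) : ℝ :=
  δ * profileBump (δ * ‖z‖⁻¹) * ‖z‖⁻¹ ^ 4

variable {δ : ℝ} {z : E3}

theorem newtonKernel_of_ge (hδ : 0 < δ) (hz : δ ≤ ‖z‖) :
    newtonKernel δ z = profileSlope * ‖z‖⁻¹ := by
  have hz0 : 0 < ‖z‖ := hδ.trans_le hz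
  have h : δ * ‖z‖⁻¹ ≤ 1 := by rw [← div_eq_mul_inv]; exact (div_le_one hz0).2 hz
  rw [newtonKernel, if_neg (norm_pos_iff.1 hz0), profile_of_le h]
  field_simp

theorem newtonKernel_of_le (hz : ‖z‖ ≤ δ / 2) :
    newtonKernel δ z = δ⁻¹ * profile 2 := by
  rw [newtonKernel]
  split_ifs with h
  · rfl
  · have hz0 : 0 < ‖z‖ := norm_pos_iff.2 h
    rw [profile_of_ge]
    rw [← div_eq_mul_inv, le_div_iff₀ hz0]; linarith

theorem newtonKernel_eventuallyEq_const (hz : ‖z‖ < δ / 2) :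
    newtonKernel δ =ᶠ[𝓝 z] fun _ => δ⁻¹ * profile 2 := by
  filter_upwards [(isOpen_lt continuous_norm continuous_const).mem_nhds hz] with y hy
  exact newtonKernel_of_le (le_of_lt hy)

theorem newtonKernel_eventuallyEq (hz : z ≠ 0) :
    newtonKernel δ =ᶠ[𝓝 z] fun y => δ⁻¹ * profile (δ * ‖y‖⁻¹) := by
  filter_upwards [isOpen_ne.mem_nhds hz] with y hy
  rw [newtonKernel, if_neg hy]

theorem contDiff_newtonKernel (hδ : 0 < δ) : ContDiff ℝ ∞ (newtonKernel δ) := by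
  rw [contDiff_iff_contDiffAt]
  intro z
  rcases eq_or_ne z 0 with rfl | hz
  · exact contDiffAt_const.congr_of_eventuallyEq
      (newtonKernel_eventuallyEq_const (by simpa using hδ))
  · exact (contDiffAt_const.mul (contDiff_profile.contDiffAt.comp z
      (contDiffAt_const.mul (contDiffAt_inv_norm hz)))).congr_of_eventuallyEq
      (newtonKernel_eventuallyEq hz)

theorem laplacian3_newtonKernel (hδ : 0 < δ) : laplacian3 (newtonKernel δ) z = -newtonMass δ z := by
  rcases eq_or_ne z 0 with rfl | hz
  · rw [(newtonKernel_eventuallyEq_const (by simpa using hδ)).laplacian3, laplacian3_const]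
    simp [newtonMass]
  · have hc : ContDiffAt ℝ 2 (fun y : E3 => ‖y‖⁻¹) z := contDiffAt_inv_norm hz
    have hc' : ContDiffAt ℝ 2 (fun y : E3 => δ * ‖y‖⁻¹) z := contDiffAt_const.mul hc
    have hp : ContDiff ℝ 2 profile := contDiff_infty.1 contDiff_profile 2
    have hpc : ContDiffAt ℝ 2 (fun y : E3 => profile (δ * ‖y‖⁻¹)) z := hp.contDiffAt.comp z hc'
    rw [(newtonKernel_eventuallyEq hz).laplacian3,
      laplacian3_const_mul _ hpc, laplacian3_comp hp hc',
      laplacian3_const_mul _ hc, laplacian3_inv_norm hz, deriv_profile, deriv_profileDeriv]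
    simp only [partialD_const_mul, mul_pow, ← Finset.mul_sum, sum_sq_partialD_inv_norm hz]
    rw [newtonMass]
    field_simp
    ring

theorem newtonMass_nonneg (hδ : 0 < δ) : 0 ≤ newtonMass δ z := by
  have := profileBump.nonneg (x := δ * ‖z‖⁻¹)
  unfold newtonMass
  positivity

theorem newtonMass_of_ge (hδ : 0 < δ) (hz : δ ≤ ‖z‖) : newtonMass δ z = 0 := by
  have hz0 : 0 < ‖z‖ := hδ.trans_le hz
  rw [newtonMass, profileBump_of_le]
  · simp
  · rw [← div_eq_mul_inv]; exact (div_le_one hz0).2 hz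

theorem le_newtonMass (hδ : 0 < δ) (h1 : 3 / 5 * δ ≤ ‖z‖) (h2 : ‖z‖ ≤ 3 / 4 * δ) :
    (δ ^ 3)⁻¹ ≤ newtonMass δ z := by
  have hz0 : 0 < ‖z‖ := lt_of_lt_of_le (by positivity) h1
  rw [newtonMass, profileBump_eq_one]
  · have h3 : δ⁻¹ ≤ ‖z‖⁻¹ := inv_anti₀ hz0 (by linarith)
    calc (δ ^ 3)⁻¹ = δ * 1 * δ⁻¹ ^ 4 := by field_simp
      _ ≤ _ := by gcongr
  · rw [← div_eq_mul_inv, le_div_iff₀ hz0]; linarith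
  · rw [← div_eq_mul_inv, div_le_iff₀ hz0]; linarith

theorem continuous_newtonMass (hδ : 0 < δ) : Continuous (newtonMass δ) := by
  have h : newtonMass δ = fun z => -laplacian3 (newtonKernel δ) z := by
    ext z; rw [laplacian3_newtonKernel hδ, neg_neg]
  rw [h]
  exact (contDiff_infty.1 (contDiff_newtonKernel hδ) 2).continuous_laplacian3.neg

theorem hasCompactSupport_newtonMass (hδ : 0 < δ) : HasCompactSupport (newtonMass δ) :=
  HasCompactSupport.intro (isCompact_closedBall 0 δ) fun _ hz =>
    newtonMass_of_ge hδ (by simpa using (not_le.1 (by simpa using hz)).le)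

theorem integral_newtonMass (hδ : 0 < δ) : ∫ z, newtonMass δ z = ∫ z, newtonMass 1 z := by
  have h : ∀ z, newtonMass δ z = (δ ^ 3)⁻¹ * newtonMass 1 (δ⁻¹ • z) := by
    intro z
    simp only [newtonMass, norm_smul, Real.norm_eq_abs, abs_of_pos (inv_pos.2 hδ), mul_inv,
      inv_inv, one_mul, mul_pow]
    field_simp
  simp only [h]
  rw [integral_const_mul, Measure.integral_comp_inv_smul, finrank_euclideanSpace_fin,
    abs_of_pos (by positivity), smul_eq_mul, ← mul_assoc, inv_mul_cancel₀ (by positivity), one_mul]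

/-- The total mass of `newtonMass δ`, which does not depend on `δ`. -/
noncomputable def totalMass : ℝ := ∫ z, newtonMass 1 z

theorem totalMass_pos : 0 < totalMass := by
  refine (continuous_newtonMass one_pos).integral_pos_of_hasCompactSupport_nonneg_nonzero
    (hasCompactSupport_newtonMass one_pos) (fun z => newtonMass_nonneg one_pos)
    (x := EuclideanSpace.single 0 (2 / 3)) ?_
  have h : ‖(EuclideanSpace.single 0 (2 / 3 : ℝ) : E3)‖ = 2 / 3 := by
    rw [PiLp.norm_single, Real.norm_eq_abs, abs_of_pos (by norm_num)]
  have := le_newtonMass (z := EuclideanSpace.single 0 (2 / 3)) one_pos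
    (by rw [h]; norm_num) (by rw [h]; norm_num)
  norm_num at this
  linarith

end Kernel

section Cutoffs

/-- The first-order terms `Δ(f * g) - f * Δ g` of the product rule for the Laplacian. -/
noncomputable def laplacianCommutator (f g : E3 → ℝ) (y : E3) : ℝ :=
  2 * ∑ i, partialD i f y * partialD i g y + g y * laplacian3 f y

variable {f g h : E3 → ℝ} {a R : ℝ}

theorem laplacian3_mul_eq_commutator {x : E3} (hf : ContDiffAt ℝ 2 f x) (hg : ContDiffAt ℝ 2 g x) :
    laplacian3 (fun y => f y * g y) x = f x * laplacian3 g x + laplacianCommutator f g x := by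
  rw [laplacian3_mul hf hg, laplacianCommutator, add_assoc]

theorem continuous_laplacianCommutator (hf : ContDiff ℝ 2 f) (hg : ContDiff ℝ 2 g) :
    Continuous (laplacianCommutator f g) := by
  have hf1 : ∀ i, Continuous (partialD i f) := fun i =>
    (hf.partialD (m := 1) (by norm_num)).continuous
  have hg1 : ∀ i, Continuous (partialD i g) := fun i =>
    (hg.partialD (m := 1) (by norm_num)).continuous
  exact (continuous_const.mul (continuous_finsetSum _ fun i _ => (hf1 i).mul (hg1 i))).add
    (hg.continuous.mul hf.continuous_laplacian3)

theorem laplacianCommutator_eq_zero {y : E3} {c : ℝ} (hf : f =ᶠ[𝓝 y] fun _ => c) :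
    laplacianCommutator f g y = 0 := by
  have h1 : ∀ i, partialD i f y = 0 := fun i => by rw [hf.partialD.eq_of_nhds, partialD_const]
  simp [laplacianCommutator, h1, hf.laplacian3, laplacian3_const]

theorem laplacianCommutator_congr {y : E3} (hg : g =ᶠ[𝓝 y] h) :
    laplacianCommutator f g y = laplacianCommutator f h y := by
  have h1 : ∀ i, partialD i g y = partialD i h y := fun i => hg.partialD.eq_of_nhds
  simp [laplacianCommutator, h1, hg.eq_of_nhds]

/-- `f` is locally constant off the closed annulus of radii `a` and `R` about the origin. -/
def LocallyConstOffAnnulus (f : E3 → ℝ) (a R : ℝ) : Prop :=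
  ∀ y : E3, ‖y‖ < a ∨ R < ‖y‖ → ∃ c : ℝ, f =ᶠ[𝓝 y] fun _ => c

theorem LocallyConstOffAnnulus.partialD (hf : LocallyConstOffAnnulus f a R) (i : Fin 3) :
    VanishesOffAnnulus (partialD i f) a R := by
  constructor <;> intro y hy
  · obtain ⟨c, hc⟩ := hf y (Or.inl hy)
    rw [hc.partialD.eq_of_nhds, partialD_const]
  · obtain ⟨c, hc⟩ := hf y (Or.inr hy)
    rw [hc.partialD.eq_of_nhds, partialD_const]

theorem LocallyConstOffAnnulus.laplacian3 (hf : LocallyConstOffAnnulus f a R) :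
    VanishesOffAnnulus (laplacian3 f) a R := by
  constructor <;> intro y hy
  · obtain ⟨c, hc⟩ := hf y (Or.inl hy)
    rw [hc.laplacian3, laplacian3_const]
  · obtain ⟨c, hc⟩ := hf y (Or.inr hy)
    rw [hc.laplacian3, laplacian3_const]

theorem LocallyConstOffAnnulus.commutator (hf : LocallyConstOffAnnulus f a R) (g : E3 → ℝ) :
    VanishesOffAnnulus (laplacianCommutator f g) a R := by
  constructor <;> intro y hy
  · obtain ⟨c, hc⟩ := hf y (Or.inl hy)
    exact laplacianCommutator_eq_zero hc
  · obtain ⟨c, hc⟩ := hf y (Or.inr hy)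
    exact laplacianCommutator_eq_zero hc

theorem ContDiffBump.locallyConstOffAnnulus (η : ContDiffBump (0 : E3)) :
    LocallyConstOffAnnulus η η.rIn η.rOut := by
  rintro y (hy | hy)
  · exact ⟨1, η.eventuallyEq_one_of_mem_ball (by simpa using hy)⟩
  · refine ⟨0, ?_⟩
    filter_upwards [(isOpen_lt continuous_const continuous_norm).mem_nhds hy] with z hz
    exact η.zero_of_le_dist (by simpa using le_of_lt hz)

theorem ContDiffBump.contDiff_two (η : ContDiffBump (0 : E3)) : ContDiff ℝ 2 η :=
  contDiff_infty.1 η.contDiff 2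

/-- A smooth cutoff equal to `1` for `‖y‖ ≤ 3 / 5` and to `0` for `3 / 4 ≤ ‖y‖`. -/
noncomputable def unitCutoff : ContDiffBump (0 : E3) := ⟨3 / 5, 3 / 4, by norm_num, by norm_num⟩

/-- The cutoff `unitCutoff` rescaled to radius `ε`. -/
noncomputable def scaledCutoff (ε : ℝ) (y : E3) : ℝ := unitCutoff (ε⁻¹ • y)

variable {ε : ℝ}

theorem contDiff_scaledCutoff : ContDiff ℝ 2 (scaledCutoff ε) :=
  unitCutoff.contDiff_two.comp (contDiff_const_smul _)

theorem scaledCutoff_of_le (hε : 0 < ε) {y : E3} (hy : ‖y‖ ≤ 3 / 5 * ε) : scaledCutoff ε y = 1 :=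
  unitCutoff.one_of_mem_closedBall (by
    rw [mem_closedBall_zero_iff, norm_smul, Real.norm_eq_abs, abs_of_pos (inv_pos.2 hε),
      inv_mul_le_iff₀ hε]
    simp only [unitCutoff]
    linarith)

theorem scaledCutoff_of_ge (hε : 0 < ε) {y : E3} (hy : 3 / 4 * ε ≤ ‖y‖) : scaledCutoff ε y = 0 :=
  unitCutoff.zero_of_le_dist (by
    rw [dist_zero_right, norm_smul, Real.norm_eq_abs, abs_of_pos (inv_pos.2 hε),
      le_inv_mul_iff₀ hε]
    simp only [unitCutoff]
    linarith)

theorem locallyConstOffAnnulus_scaledCutoff (hε : 0 < ε) :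
    LocallyConstOffAnnulus (scaledCutoff ε) (3 / 5 * ε) (3 / 4 * ε) := by
  rintro y (hy | hy)
  · refine ⟨1, ?_⟩
    filter_upwards [(isOpen_lt continuous_norm continuous_const).mem_nhds hy] with z hz
    exact scaledCutoff_of_le hε (le_of_lt hz)
  · refine ⟨0, ?_⟩
    filter_upwards [(isOpen_lt continuous_const continuous_norm).mem_nhds hy] with z hz
    exact scaledCutoff_of_ge hε (le_of_lt hz)

theorem exists_abs_scaledCutoff_deriv_le :
    ∃ D : ℝ, 0 ≤ D ∧ ∀ ε : ℝ, 0 < ε → ∀ y, (∀ i, |partialD i (scaledCutoff ε) y| ≤ ε⁻¹ * D) ∧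
      |laplacian3 (scaledCutoff ε) y| ≤ ε⁻¹ ^ 2 * D := by
  have hc : ContDiff ℝ 2 unitCutoff := unitCutoff.contDiff_two
  have hK : HasCompactSupport unitCutoff := unitCutoff.hasCompactSupport
  obtain ⟨D₁, hD₁⟩ := (hK.fderiv (𝕜 := ℝ)).exists_bound_of_continuous
    (hc.continuous_fderiv (by norm_num))
  have hΔ : HasCompactSupport (laplacian3 unitCutoff) :=
    unitCutoff.locallyConstOffAnnulus.laplacian3.hasCompactSupport
  obtain ⟨D₂, hD₂⟩ := hΔ.exists_bound_of_continuous hc.continuous_laplacian3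
  refine ⟨max D₁ D₂, le_max_of_le_left ((norm_nonneg _).trans (hD₁ 0)),
    fun ε hε y => ⟨fun i => ?_, ?_⟩⟩
  · rw [show scaledCutoff ε = fun y => unitCutoff (ε⁻¹ • y) from rfl, partialD_comp_smul, abs_mul,
      abs_of_pos (inv_pos.2 hε)]
    gcongr
    exact abs_partialD_le.trans ((hD₁ _).trans (le_max_left _ _))
  · rw [show scaledCutoff ε = fun y => unitCutoff (ε⁻¹ • y) from rfl, laplacian3_comp_smul, abs_mul,
      abs_of_pos (by positivity)]
    gcongr
    exact (hD₂ _).trans (le_max_right _ _)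

theorem exists_abs_commutator_scaledCutoff_le (hh : ContDiff ℝ 2 h) (h0 : h 0 = 0) :
    ∃ C : ℝ, ∀ ε : ℝ, 0 < ε → ε ≤ 1 → ∀ y,
      |laplacianCommutator (scaledCutoff ε) h y| ≤ C * ε ^ 2 * newtonMass ε y := by
  obtain ⟨D, hD0, hD⟩ := exists_abs_scaledCutoff_deriv_le
  obtain ⟨C, hC⟩ := (isCompact_closedBall (0 : E3) 1).exists_bound_of_continuousOn
    (hh.continuous_fderiv (by norm_num)).continuousOn
  have hC0 : 0 ≤ C := (norm_nonneg _).trans (hC 0 (by simp))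
  refine ⟨7 * (D * C), fun ε hε hε1 y => ?_⟩
  by_cases hy : ‖y‖ < 3 / 5 * ε ∨ 3 / 4 * ε < ‖y‖
  · obtain ⟨c, hc⟩ := locallyConstOffAnnulus_scaledCutoff hε y hy
    rw [laplacianCommutator_eq_zero hc, abs_zero]
    have := newtonMass_nonneg hε (z := y)
    positivity
  push Not at hy
  have hy1 : y ∈ closedBall (0 : E3) 1 := by
    rw [mem_closedBall_zero_iff]; linarith [hy.2]
  have hh1 : |h y| ≤ C * ε := by
    have := (convex_closedBall (0 : E3) 1).norm_image_sub_le_of_norm_fderiv_le (𝕜 := ℝ) (f := h)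
      (fun x _ => hh.differentiable (by norm_num) x) hC (mem_closedBall_self zero_le_one) hy1
    rw [h0, sub_zero, sub_zero] at this
    exact this.trans (by gcongr; linarith [hy.2])
  obtain ⟨hD1, hD2⟩ := hD ε hε y
  have hsum : |∑ i, partialD i (scaledCutoff ε) y * partialD i h y| ≤ 3 * (ε⁻¹ * D * C) := by
    refine (Finset.abs_sum_le_sum_abs _ _).trans ?_
    have : ∀ i ∈ Finset.univ, |partialD i (scaledCutoff ε) y * partialD i h y| ≤ ε⁻¹ * D * C := by
      intro i _
      rw [abs_mul]
      exact mul_le_mul (hD1 i) (abs_partialD_le.trans (hC y hy1)) (abs_nonneg _) (by positivity)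
    simpa using Finset.sum_le_card_nsmul _ _ _ this
  calc |laplacianCommutator (scaledCutoff ε) h y|
      ≤ 2 * (3 * (ε⁻¹ * D * C)) + C * ε * (ε⁻¹ ^ 2 * D) := by
        refine (abs_add_le _ _).trans (add_le_add ?_ ?_)
        · rw [abs_mul, abs_of_pos (by norm_num : (0 : ℝ) < 2)]
          gcongr
        · rw [abs_mul]
          exact mul_le_mul hh1 hD2 (abs_nonneg _) (by positivity)
    _ = 7 * (D * C) * ε ^ 2 * (ε ^ 3)⁻¹ := by field_simp; ring
    _ ≤ _ := by
        gcongr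
        exact le_newtonMass hε hy.1 hy.2

end Cutoffs

section Representation

variable {U : Set E3} {Φ h : E3 → ℝ} {r ε δ : ℝ} {x : E3}

theorem VanishesOffAnnulus.mono {p : E3 → ℝ} {a a' R R' : ℝ} (hp : VanishesOffAnnulus p a R)
    (ha : a' ≤ a) (hR : R ≤ R') : VanishesOffAnnulus p a' R' :=
  ⟨fun y hy => hp.1 y (hy.trans_le ha), fun y hy => hp.2 y (hR.trans_lt hy)⟩

theorem contDiff_two_newtonKernel (hδ : 0 < δ) : ContDiff ℝ 2 (newtonKernel δ) :=
  contDiff_infty.1 (contDiff_newtonKernel hδ) 2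

theorem newtonKernel_eventuallyEq_inv_norm (hδ : 0 < δ) (hx : δ < ‖x‖) :
    newtonKernel δ =ᶠ[𝓝 x] fun z => profileSlope * ‖z‖⁻¹ := by
  filter_upwards [(isOpen_lt continuous_const continuous_norm).mem_nhds hx] with z hz
  exact newtonKernel_of_ge hδ (le_of_lt hz)

theorem vanishesOffAnnulus_newtonMass (hδ : 0 < δ) :
    VanishesOffAnnulus (newtonMass δ) (δ / 2) δ := by
  refine ⟨fun y hy => ?_, fun y hy => newtonMass_of_ge hδ hy.le⟩
  rw [← neg_eq_zero, ← laplacian3_newtonKernel hδ,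
    (newtonKernel_eventuallyEq_const hy).laplacian3, laplacian3_const]

theorem vanishesOffAnnulus_newtonMass_sub (hδ : 0 < δ) (hδx : δ ≤ ‖x‖ / 2) (hxr : ‖x‖ < r / 2) :
    VanishesOffAnnulus (fun y => newtonMass δ (x - y)) (‖x‖ / 2) r := by
  constructor <;> intro y hy <;> refine newtonMass_of_ge hδ ?_
  · linarith [norm_sub_norm_le x y]
  · linarith [norm_sub_norm_le y x, norm_sub_rev x y]

theorem ContDiffBump.eq_one_of_norm_le (η : ContDiffBump (0 : E3)) (hx : ‖x‖ ≤ η.rIn) : η x = 1 :=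
  η.one_of_mem_closedBall (by simpa using hx)

theorem ContDiffBump.eq_zero_of_le_norm (η : ContDiffBump (0 : E3)) (hx : η.rOut ≤ ‖x‖) : η x = 0 :=
  η.zero_of_le_dist (by simpa using hx)

/-- The mass of a nonnegative harmonic function near its singularity, at scale `ε`. -/
theorem HarmonicOn3.exists_integral_mul_newtonMass_eq (hU : IsOpen U)
    (hΦ : HarmonicOn3 Φ (U \ {0})) (η : ContDiffBump (0 : E3)) (hη : closedBall 0 η.rOut ⊆ U) :
    ∃ P Q : ℝ, ∀ ε : ℝ, 0 < ε → ε < η.rIn →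
      ∫ y, Φ y * newtonMass ε y = ε⁻¹ * P + Q := by
  have hr := η.rIn_pos
  have hηc := η.contDiff_two
  have hηa := η.locallyConstOffAnnulus
  have hr2 : 0 < η.rIn / 2 := by positivity
  refine ⟨-(profile 2 * ∫ y, Φ y * laplacian3 η y),
    ∫ y, Φ y * laplacianCommutator η (newtonKernel (η.rIn / 2)) y, fun ε hε hεr => ?_⟩
  have hk : ContDiff ℝ 2 fun y => ε⁻¹ * profile 2 - newtonKernel ε y :=
    contDiff_const.sub (contDiff_two_newtonKernel hε)
  have hT : ContDiff ℝ 2 fun y => η y * (ε⁻¹ * profile 2 - newtonKernel ε y) := hηc.mul hk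
  have hTa : VanishesOffAnnulus (fun y => η y * (ε⁻¹ * profile 2 - newtonKernel ε y))
      (ε / 2) η.rOut :=
    ⟨fun y hy => by simp [newtonKernel_of_le hy.le],
      fun y hy => by simp [η.eq_zero_of_le_norm hy.le]⟩
  have hint := hΦ.integral_mul_laplacian3_eq_zero hU (by positivity) hη hT hTa
  have hm1 := ((vanishesOffAnnulus_newtonMass hε).mono le_rfl
    (hεr.le.trans η.rIn_lt_rOut.le)).integrable_mul hU (by positivity) hη hΦ.1.continuousOn
    (continuous_newtonMass hε)
  have hm2 := hηa.laplacian3.integrable_mul hU hr hη hΦ.1.continuousOn hηc.continuous_laplacian3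
  have hm3 := (hηa.commutator (newtonKernel (η.rIn / 2))).integrable_mul hU hr hη
    hΦ.1.continuousOn (continuous_laplacianCommutator hηc (contDiff_two_newtonKernel hr2))
  have key : ∀ y, Φ y * laplacian3 (fun y => η y * (ε⁻¹ * profile 2 - newtonKernel ε y)) y =
      Φ y * newtonMass ε y + ε⁻¹ * profile 2 * (Φ y * laplacian3 η y) -
        Φ y * laplacianCommutator η (newtonKernel (η.rIn / 2)) y := by
    intro y
    rw [laplacian3_mul_eq_commutator hηc.contDiffAt hk.contDiffAt,
      laplacian3_sub contDiffAt_const (contDiff_two_newtonKernel hε).contDiffAt,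
      laplacian3_const, laplacian3_newtonKernel hε]
    have h1 : η y * newtonMass ε y = newtonMass ε y := by
      rcases le_or_gt ε ‖y‖ with hy | hy
      · simp [newtonMass_of_ge hε hy]
      · simp [η.eq_one_of_norm_le (hy.trans hεr).le]
    have h2 : laplacianCommutator η (fun y => ε⁻¹ * profile 2 - newtonKernel ε y) y =
        ε⁻¹ * profile 2 * laplacian3 η y - laplacianCommutator η (newtonKernel (η.rIn / 2)) y := by
      by_cases hy : ‖y‖ < η.rIn ∨ η.rOut < ‖y‖
      · obtain ⟨c, hc⟩ := hηa y hy
        simp [laplacianCommutator_eq_zero hc, hc.laplacian3, laplacian3_const]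
      · push Not at hy
        have he : newtonKernel ε =ᶠ[𝓝 y] newtonKernel (η.rIn / 2) :=
          (newtonKernel_eventuallyEq_inv_norm hε (hεr.trans_le hy.1)).trans
            (newtonKernel_eventuallyEq_inv_norm hr2 (by linarith [hy.1])).symm
        rw [← laplacianCommutator_congr he]
        have hp : ∀ i, partialD i (fun y => ε⁻¹ * profile 2 - newtonKernel ε y) y =
            -partialD i (newtonKernel ε) y := fun i => by
          rw [partialD_sub (differentiableAt_const _)
            ((contDiff_two_newtonKernel hε).differentiable (by norm_num) y), partialD_const,
            zero_sub]
        simp only [laplacianCommutator, hp, mul_neg, Finset.sum_neg_distrib]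
        ring
    rw [h2]
    linear_combination Φ y * h1
  simp only [key] at hint
  have hm12 : Integrable fun y => Φ y * newtonMass ε y + ε⁻¹ * profile 2 * (Φ y * laplacian3 η y) :=
    hm1.add (hm2.const_mul _)
  rw [integral_sub hm12 hm3, integral_add hm1 (hm2.const_mul _), integral_const_mul] at hint
  linear_combination hint

/-- Cutting off at the singularity costs nothing in the limit, against functions vanishing
at `0`. -/
theorem HarmonicOn3.tendsto_integral_mul_commutator_scaledCutoff (hU : IsOpen U)
    (hΦ : HarmonicOn3 Φ (U \ {0})) (hΦ0 : ∀ y ∈ U \ {0}, 0 ≤ Φ y)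
    (η : ContDiffBump (0 : E3)) (hη : closedBall 0 η.rOut ⊆ U)
    (hh : ContDiff ℝ 2 h) (h0 : h 0 = 0) :
    Tendsto (fun ε => ∫ y, Φ y * laplacianCommutator (scaledCutoff ε) h y) (𝓝[>] 0) (𝓝 0) := by
  obtain ⟨P, Q, hPQ⟩ := hΦ.exists_integral_mul_newtonMass_eq hU η hη
  obtain ⟨C, hC⟩ := exists_abs_commutator_scaledCutoff_le hh h0
  have hlim : Tendsto (fun ε : ℝ => C * (ε * P + ε ^ 2 * Q)) (𝓝[>] 0) (𝓝 0) := by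
    have : Continuous fun ε : ℝ => C * (ε * P + ε ^ 2 * Q) := by fun_prop
    simpa using (this.tendsto 0).mono_left nhdsWithin_le_nhds
  refine squeeze_zero_norm' ?_ hlim
  filter_upwards [Ioo_mem_nhdsGT (lt_min one_pos η.rIn_pos)] with ε hε
  obtain ⟨hε0, hε1⟩ := hε
  rw [lt_min_iff] at hε1
  have hsub : closedBall (0 : E3) ε ⊆ U :=
    (closedBall_subset_closedBall (hε1.2.le.trans η.rIn_lt_rOut.le)).trans hη
  have hm := (vanishesOffAnnulus_newtonMass hε0).integrable_mul hU (by positivity) hsub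
    hΦ.1.continuousOn (continuous_newtonMass hε0)
  have hb : ∀ y, ‖Φ y * laplacianCommutator (scaledCutoff ε) h y‖ ≤
      C * ε ^ 2 * (Φ y * newtonMass ε y) := by
    intro y
    by_cases hy : ‖y‖ < ε / 2 ∨ ε < ‖y‖
    · have h1 := ((vanishesOffAnnulus_newtonMass hε0).eventuallyEq_zero hy).eq_of_nhds
      have h2 := hC ε hε0 hε1.1.le y
      rw [h1, mul_zero] at h2
      rw [h1, abs_eq_zero.1 (le_antisymm h2 (abs_nonneg _))]
      simp
    · have hy0 := hΦ0 y (mem_diff_singleton_of_annulus (by positivity) hsub hy)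
      rw [norm_mul, Real.norm_eq_abs, abs_of_nonneg hy0, Real.norm_eq_abs]
      calc _ ≤ Φ y * (C * ε ^ 2 * newtonMass ε y) := by
            gcongr
            exact hC ε hε0 hε1.1.le y
        _ = _ := by ring
  calc _ ≤ ∫ y, C * ε ^ 2 * (Φ y * newtonMass ε y) :=
        norm_integral_le_of_norm_le (hm.const_mul _) (ae_of_all _ hb)
    _ = C * (ε * P + ε ^ 2 * Q) := by
        rw [integral_const_mul, hPQ ε hε0 hε1.2]
        field_simp

theorem HarmonicOn3.integral_mul_newtonMass_sub (hU : IsOpen U)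
    (hΦ : HarmonicOn3 Φ (U \ {0})) (hΦ0 : ∀ y ∈ U \ {0}, 0 ≤ Φ y)
    (η : ContDiffBump (0 : E3)) (hη : closedBall 0 η.rOut ⊆ U)
    (hx : x ≠ 0) (hxη : ‖x‖ < η.rIn / 2) (hδ : 0 < δ) (hδx : δ ≤ ‖x‖ / 2) :
    ∫ y, Φ y * newtonMass δ (x - y) = ∫ y, Φ y *
      laplacianCommutator η (fun y => newtonKernel δ (x - y) - profileSlope * ‖x‖⁻¹) y := by
  have hr := η.rIn_pos
  have hx0 : 0 < ‖x‖ := norm_pos_iff.2 hx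
  have hηc := η.contDiff_two
  have hηa := η.locallyConstOffAnnulus
  set h : E3 → ℝ := fun y => newtonKernel δ (x - y) - profileSlope * ‖x‖⁻¹ with h_def
  have hk : ContDiff ℝ 2 fun y => newtonKernel δ (x - y) :=
    (contDiff_two_newtonKernel hδ).comp (contDiff_const.sub contDiff_id)
  have hh : ContDiff ℝ 2 h := hk.sub contDiff_const
  have hΔ : ∀ y, laplacian3 h y = -newtonMass δ (x - y) := fun y => by
    rw [h_def, laplacian3_sub hk.contDiffAt contDiffAt_const, laplacian3_const,
      laplacian3_comp_const_sub, laplacian3_newtonKernel hδ, sub_zero]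
  have h0 : h 0 = 0 := by
    simp [h_def, newtonKernel_of_ge hδ (show δ ≤ ‖x‖ by linarith)]
  have hmc : Continuous fun y => newtonMass δ (x - y) :=
    (continuous_newtonMass hδ).comp (continuous_const.sub continuous_id)
  have hm1 := ((vanishesOffAnnulus_newtonMass_sub hδ hδx hxη).mono le_rfl
    η.rIn_lt_rOut.le).integrable_mul hU (by positivity) hη hΦ.1.continuousOn hmc
  have hm2 := (hηa.commutator h).integrable_mul hU hr hη hΦ.1.continuousOn
    (continuous_laplacianCommutator hηc hh)
  have hlim := hΦ.tendsto_integral_mul_commutator_scaledCutoff hU hΦ0 η hη hh h0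
  have hev : (fun ε => ∫ y, Φ y * laplacianCommutator (scaledCutoff ε) h y) =ᶠ[𝓝[>] 0]
      fun _ => ∫ y, Φ y * laplacianCommutator η h y - Φ y * newtonMass δ (x - y) := by
    filter_upwards [Ioo_mem_nhdsGT (show (0 : ℝ) < ‖x‖ / 2 by positivity)] with ε hε
    obtain ⟨hε0, hε1⟩ := hε
    have hθa := locallyConstOffAnnulus_scaledCutoff hε0
    have hm3 := ((hθa.commutator h).mono le_rfl (R' := η.rOut)
      (by linarith [η.rIn_lt_rOut])).integrable_mul hU (by positivity) hη hΦ.1.continuousOn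
      (continuous_laplacianCommutator contDiff_scaledCutoff hh)
    have hf : ContDiff ℝ 2 fun y => η y - scaledCutoff ε y := hηc.sub contDiff_scaledCutoff
    have hTa : VanishesOffAnnulus (fun y => (η y - scaledCutoff ε y) * h y)
        (3 / 5 * ε) η.rOut := by
      refine VanishesOffAnnulus.mul_right ⟨fun y hy => ?_, fun y hy => ?_⟩ h
      · rw [η.eq_one_of_norm_le (by linarith), scaledCutoff_of_le hε0 hy.le, sub_self]
      · rw [η.eq_zero_of_le_norm hy.le,
          scaledCutoff_of_ge hε0 (by linarith [η.rIn_lt_rOut]), sub_self]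
    have hint := hΦ.integral_mul_laplacian3_eq_zero hU (by positivity) hη (hf.mul hh) hTa
    have key : ∀ y, Φ y * laplacian3 (fun y => (η y - scaledCutoff ε y) * h y) y =
        (Φ y * laplacianCommutator η h y - Φ y * newtonMass δ (x - y)) -
          Φ y * laplacianCommutator (scaledCutoff ε) h y := by
      intro y
      have h1 : (η y - scaledCutoff ε y) * newtonMass δ (x - y) = newtonMass δ (x - y) := by
        rcases le_or_gt δ ‖x - y‖ with hy | hy
        · simp [newtonMass_of_ge hδ hy]
        · rw [η.eq_one_of_norm_le (by linarith [norm_sub_norm_le y x, norm_sub_rev x y]),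
            scaledCutoff_of_ge hε0 (by linarith [norm_sub_norm_le x y])]
          ring
      have h2 : laplacianCommutator (fun y => η y - scaledCutoff ε y) h y =
          laplacianCommutator η h y - laplacianCommutator (scaledCutoff ε) h y := by
        have hp : ∀ i, partialD i (fun y => η y - scaledCutoff ε y) y =
            partialD i η y - partialD i (scaledCutoff ε) y := fun i =>
          partialD_sub (hηc.differentiable (by norm_num) y)
            (contDiff_scaledCutoff.differentiable (by norm_num) y)
        simp only [laplacianCommutator, hp, sub_mul, Finset.sum_sub_distrib,
          laplacian3_sub hηc.contDiffAt (contDiff_scaledCutoff (ε := ε)).contDiffAt]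
        ring
      rw [laplacian3_mul_eq_commutator hf.contDiffAt hh.contDiffAt, hΔ, h2]
      linear_combination -Φ y * h1
    simp only [key] at hint
    have hm21 : Integrable fun y => Φ y * laplacianCommutator η h y - Φ y * newtonMass δ (x - y) :=
      hm2.sub hm1
    rw [integral_sub hm21 hm3] at hint
    linarith
  have := tendsto_nhds_unique (tendsto_const_nhds.congr' hev.symm) hlim
  rw [integral_sub hm2 hm1] at this
  linarith

theorem HarmonicOn3.eq_of_integral_mul_newtonMass_sub (hU : IsOpen U)
    (hΦ : HarmonicOn3 Φ (U \ {0})) (hr : closedBall 0 r ⊆ U) (hx : x ≠ 0) (hxr : ‖x‖ < r / 2)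
    {L : ℝ} (hL : ∀ δ : ℝ, 0 < δ → δ ≤ ‖x‖ / 2 → ∫ y, Φ y * newtonMass δ (x - y) = L) :
    totalMass * Φ x = L := by
  have hx0 : 0 < ‖x‖ := norm_pos_iff.2 hx
  have hV : IsOpen (U \ {0}) := hU.sdiff isClosed_singleton
  have hxV : x ∈ U \ {0} := ⟨hr (by simp; linarith), hx⟩
  have hcont : ContinuousAt Φ x := hΦ.1.continuousOn.continuousAt (hV.mem_nhds hxV)
  refine eq_of_forall_dist_le fun e he => ?_
  have hκ := totalMass_pos
  obtain ⟨d, hd, hdΦ⟩ := Metric.continuousAt_iff.1 hcont (e / totalMass) (by positivity)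
  set δ := min d (‖x‖ / 2)
  have hδ : 0 < δ := lt_min hd (by positivity)
  have hδx : δ ≤ ‖x‖ / 2 := min_le_right _ _
  have hmc : Continuous fun y => newtonMass δ (x - y) :=
    (continuous_newtonMass hδ).comp (continuous_const.sub continuous_id)
  have hma := vanishesOffAnnulus_newtonMass_sub hδ hδx hxr
  have hmi : Integrable fun y => newtonMass δ (x - y) :=
    hmc.integrable_of_hasCompactSupport hma.hasCompactSupport
  have hm : ∫ y, newtonMass δ (x - y) = totalMass := by
    rw [integral_sub_left_eq_self (newtonMass δ), integral_newtonMass hδ, totalMass]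
  have hmΦ := hma.integrable_mul hU (by positivity) hr hΦ.1.continuousOn hmc
  have hdiff : totalMass * Φ x - L =
      ∫ y, Φ x * newtonMass δ (x - y) - Φ y * newtonMass δ (x - y) := by
    rw [integral_sub (hmi.const_mul _) hmΦ, integral_const_mul, hm, hL δ hδ hδx, mul_comm]
  rw [dist_eq_norm, hdiff]
  calc _ ≤ ∫ y, e / totalMass * newtonMass δ (x - y) := by
        refine norm_integral_le_of_norm_le (hmi.const_mul _) (ae_of_all _ fun y => ?_)
        have h0 := newtonMass_nonneg hδ (z := x - y)
        rw [← sub_mul, norm_mul, Real.norm_eq_abs (newtonMass _ _), abs_of_nonneg h0]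
        rcases le_or_gt δ ‖x - y‖ with hy | hy
        · simp [newtonMass_of_ge hδ hy]
        · gcongr
          rw [norm_sub_rev, ← dist_eq_norm]
          refine (hdΦ ?_).le
          rw [dist_comm, dist_eq_norm]
          exact hy.trans_le (min_le_left _ _)
    _ = e := by
        rw [integral_const_mul, hm]
        field_simp

end Representation

section Decomposition

variable {U : Set E3} {Φ : E3 → ℝ}

theorem contDiff_integral_mul_comp_sub {f J : E3 → ℝ} (hf : Continuous f) (hJ : ContDiff ℝ 2 J)
    (hJc : HasCompactSupport J) : ContDiff ℝ 2 fun x => ∫ y, f y * J (x - y) :=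
  hJc.contDiff_convolution_right (n := 2) (ContinuousLinearMap.mul ℝ ℝ) hf.locallyIntegrable hJ

theorem exists_compactSupport_eventuallyEq_inv_norm {a R : ℝ} (ha : 0 < a) (hR : 0 < R) :
    ∃ J : E3 → ℝ, ContDiff ℝ ∞ J ∧ HasCompactSupport J ∧
      ∀ z, a < ‖z‖ → ‖z‖ < R → J =ᶠ[𝓝 z] fun z => profileSlope * ‖z‖⁻¹ := by
  let b : ContDiffBump (0 : E3) := ⟨R, 2 * R, hR, by linarith⟩
  refine ⟨fun z => b z * newtonKernel a z, b.contDiff.mul (contDiff_newtonKernel ha),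
    b.hasCompactSupport.mul_right, fun z hz hzR => ?_⟩
  filter_upwards [newtonKernel_eventuallyEq_inv_norm ha hz,
    b.eventuallyEq_one_of_mem_ball (x := z) (by simpa using hzR)] with y h1 h2
  rw [h1, h2, Pi.one_apply, one_mul]

/-- Near an isolated singularity, a nonnegative harmonic function differs from a multiple of the
Newtonian kernel by a function that is regular across the singularity. -/
theorem HarmonicOn3.exists_eq_inv_norm_add (hU : IsOpen U)
    (hΦ : HarmonicOn3 Φ (U \ {0})) (hΦ0 : ∀ y ∈ U \ {0}, 0 ≤ Φ y)
    (η : ContDiffBump (0 : E3)) (hη : closedBall 0 η.rOut ⊆ U) :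
    ∃ (c : ℝ) (φ : E3 → ℝ), ContDiff ℝ 2 φ ∧
      ∀ x : E3, x ≠ 0 → ‖x‖ < η.rIn / 2 → Φ x = c * ‖x‖⁻¹ + φ x := by
  have hr := η.rIn_pos
  have hηc := η.contDiff_two
  have hηa := η.locallyConstOffAnnulus
  have hκ := totalMass_pos
  obtain ⟨J, hJ, hJc, hJe⟩ := exists_compactSupport_eventuallyEq_inv_norm
    (a := η.rIn / 2) (R := 2 * η.rOut) (by positivity) (by linarith [η.rIn_lt_rOut])
  have hJ2 : ContDiff ℝ 2 J := contDiff_infty.1 hJ 2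
  have hJi : ∀ i, ContDiff ℝ 2 (partialD i J) := fun i =>
    (contDiff_infty.1 hJ 3).partialD (by norm_num)
  have hJic : ∀ i, HasCompactSupport (partialD i J) := fun i =>
    (hJc.fderiv (𝕜 := ℝ)).comp_left (g := fun L : E3 →L[ℝ] ℝ => L (EuclideanSpace.single i 1))
      (by simp)
  have hL : Continuous fun y => Φ y * laplacian3 η y :=
    hηa.laplacian3.continuous_mul hU hr hη hΦ.1.continuousOn hηc.continuous_laplacian3
  have hD : ∀ i, Continuous fun y => Φ y * partialD i η y := fun i =>
    (hηa.partialD i).continuous_mul hU hr hη hΦ.1.continuousOn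
      (hηc.partialD (m := 1) (by norm_num)).continuous
  have hLc : HasCompactSupport fun y => Φ y * laplacian3 η y :=
    (hηa.laplacian3.mul_left Φ).hasCompactSupport
  have hDc : ∀ i, HasCompactSupport fun y => Φ y * partialD i η y := fun i =>
    ((hηa.partialD i).mul_left Φ).hasCompactSupport
  set A := ∫ y, Φ y * laplacian3 η y
  let ψ : E3 → ℝ := fun x => (∫ y, Φ y * laplacian3 η y * J (x - y)) -
    2 * ∑ i, ∫ y, Φ y * partialD i η y * partialD i J (x - y)
  have hψ : ContDiff ℝ 2 ψ :=
    (contDiff_integral_mul_comp_sub hL hJ2 hJc).sub (contDiff_const.mul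
      (ContDiff.sum fun i _ => contDiff_integral_mul_comp_sub (hD i) (hJi i) (hJic i)))
  refine ⟨-(profileSlope * A / totalMass), fun x => ψ x / totalMass, hψ.div_const _,
    fun x hx hxr => ?_⟩
  have key : totalMass * Φ x = ψ x - profileSlope * ‖x‖⁻¹ * A := by
    refine hΦ.eq_of_integral_mul_newtonMass_sub hU
      ((closedBall_subset_closedBall η.rIn_lt_rOut.le).trans hη) hx hxr fun δ hδ hδx => ?_
    rw [hΦ.integral_mul_newtonMass_sub hU hΦ0 η hη hx hxr hδ hδx]
    have hpt : ∀ y, Φ y * laplacianCommutator η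
        (fun y => newtonKernel δ (x - y) - profileSlope * ‖x‖⁻¹) y =
        Φ y * laplacian3 η y * J (x - y) -
          2 * ∑ i, Φ y * partialD i η y * partialD i J (x - y) -
          profileSlope * ‖x‖⁻¹ * (Φ y * laplacian3 η y) := by
      intro y
      by_cases hy : ‖y‖ < η.rIn ∨ η.rOut < ‖y‖
      · obtain ⟨c, hc⟩ := hηa y hy
        have hp : ∀ i, partialD i η y = 0 := fun i => by rw [hc.partialD.eq_of_nhds, partialD_const]
        simp [laplacianCommutator_eq_zero hc, hc.laplacian3, laplacian3_const, hp]
      · push Not at hy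
        have hz1 : η.rIn / 2 < ‖x - y‖ := by linarith [norm_sub_norm_le y x, norm_sub_rev x y]
        have hz2 : ‖x - y‖ < 2 * η.rOut := by linarith [norm_sub_le x y, η.rIn_lt_rOut]
        have he : newtonKernel δ =ᶠ[𝓝 (x - y)] J :=
          (newtonKernel_eventuallyEq_inv_norm hδ (by linarith)).trans (hJe _ hz1 hz2).symm
        have hcomp : (fun y => newtonKernel δ (x - y) - profileSlope * ‖x‖⁻¹) =ᶠ[𝓝 y]
            fun y => J (x - y) - profileSlope * ‖x‖⁻¹ :=
          ((continuous_const.sub continuous_id).continuousAt.eventually he).mono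
            fun z hz => congrArg (· - profileSlope * ‖x‖⁻¹) hz
        have hJd : DifferentiableAt ℝ (fun y => J (x - y)) y :=
          (hJ2.comp (contDiff_const.sub contDiff_id)).differentiable (by norm_num) y
        rw [laplacianCommutator_congr hcomp]
        have hp : ∀ i, partialD i (fun y => J (x - y) - profileSlope * ‖x‖⁻¹) y =
            -partialD i J (x - y) := fun i => by
          rw [partialD_sub hJd (differentiableAt_const _), partialD_const, sub_zero,
            partialD_comp_const_sub]
        simp only [laplacianCommutator, hp, mul_neg, Finset.sum_neg_distrib,
          mul_assoc, ← Finset.mul_sum]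
        ring
    have hx1 : Continuous fun y => x - y := continuous_const.sub continuous_id
    have h1 : Integrable fun y => Φ y * laplacian3 η y * J (x - y) :=
      (hL.mul (hJ2.continuous.comp hx1)).integrable_of_hasCompactSupport hLc.mul_right
    have h2 : ∀ i, Integrable fun y => Φ y * partialD i η y * partialD i J (x - y) := fun i =>
      ((hD i).mul ((hJi i).continuous.comp hx1)).integrable_of_hasCompactSupport (hDc i).mul_right
    have h3 : Integrable fun y => 2 * ∑ i, Φ y * partialD i η y * partialD i J (x - y) :=
      (integrable_finsetSum _ fun i _ => h2 i).const_mul 2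
    have h4 : Integrable fun y => profileSlope * ‖x‖⁻¹ * (Φ y * laplacian3 η y) :=
      (hL.integrable_of_hasCompactSupport hLc).const_mul _
    have h13 : Integrable fun y => Φ y * laplacian3 η y * J (x - y) -
        2 * ∑ i, Φ y * partialD i η y * partialD i J (x - y) := h1.sub h3
    simp only [hpt]
    rw [integral_sub h13 h4, integral_sub h1 h3, integral_const_mul, integral_const_mul,
      integral_finsetSum _ fun i _ => h2 i]
  field_simp
  field_simp at key
  linear_combination key

theorem nonneg_of_nonneg_inv_norm_add {c r : ℝ} {φ : E3 → ℝ} (hr : 0 < r) (hφ : ContinuousAt φ 0)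
    (h : ∀ x : E3, x ≠ 0 → ‖x‖ < r → 0 ≤ c * ‖x‖⁻¹ + φ x) : 0 ≤ c := by
  have hlim : Tendsto (fun x : E3 => c + ‖x‖ * φ x) (𝓝[≠] 0) (𝓝 (c + ‖(0 : E3)‖ * φ 0)) :=
    (continuousAt_const.add (continuous_norm.continuousAt.mul hφ)).tendsto.mono_left
      nhdsWithin_le_nhds
  rw [norm_zero, zero_mul, add_zero] at hlim
  refine ge_of_tendsto hlim ?_
  filter_upwards [self_mem_nhdsWithin, mem_nhdsWithin_of_mem_nhds (ball_mem_nhds (0 : E3) hr)]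
    with x hx hxr
  have hx0 : 0 < ‖x‖ := norm_pos_iff.2 hx
  have := mul_nonneg hx0.le (h x hx (by simpa using hxr))
  rwa [mul_add, mul_left_comm, mul_inv_cancel₀ hx0.ne', mul_one] at this

/-- An isolated singularity across which a harmonic function extends `C²` is removable. -/
theorem HarmonicOn3.of_contDiffAt_zero (hU : IsOpen U) (hΦ : HarmonicOn3 Φ (U \ {0}))
    (h0 : (0 : E3) ∈ U) (hc : ContDiffAt ℝ 2 Φ 0) : HarmonicOn3 Φ U := by
  have hV : IsOpen (U \ {0}) := hU.sdiff isClosed_singleton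
  refine ⟨fun x hx => ?_, fun x hx => ?_⟩ <;> rcases eq_or_ne x 0 with rfl | hx0
  · exact hc.contDiffWithinAt
  · exact (hΦ.1.contDiffAt (hV.mem_nhds ⟨hx, hx0⟩)).contDiffWithinAt
  · have hcont : ContinuousAt (laplacian3 Φ) 0 := by
      have h : ∀ i, ContinuousAt (partialD i (partialD i Φ)) 0 := fun i =>
        ((hc.partialD (m := 1) (by norm_num)).partialD (m := 0) (by norm_num)).continuousAt
      exact tendsto_finsetSum _ fun i _ => h i
    refine tendsto_nhds_unique (hcont.tendsto.mono_left nhdsWithin_le_nhds :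
      Tendsto (laplacian3 Φ) (𝓝[≠] 0) _) (tendsto_const_nhds.congr' ?_)
    filter_upwards [self_mem_nhdsWithin, mem_nhdsWithin_of_mem_nhds (hU.mem_nhds h0)] with y hy hyU
    exact (hΦ.2 y ⟨hyU, hy⟩).symm
  · exact hΦ.2 x ⟨hx, hx0⟩

end Decomposition

/-- Bôcher-type decomposition: a nonnegative harmonic function on a punctured
neighbourhood of `0` in `ℝ³` is `c/|x|` plus a harmonic function. -/
theorem bocher_decomposition
    (U : Set (EuclideanSpace ℝ (Fin 3))) (hU : IsOpen U) (h0 : (0 : EuclideanSpace ℝ (Fin 3)) ∈ U)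
    (Φ : EuclideanSpace ℝ (Fin 3) → ℝ)
    (hΦharm : HarmonicOn3 Φ (U \ {0}))
    (hΦnonneg : ∀ x ∈ U \ ({0} : Set (EuclideanSpace ℝ (Fin 3))), 0 ≤ Φ x) :
    ∃ (c : ℝ) (φ : EuclideanSpace ℝ (Fin 3) → ℝ), 0 ≤ c ∧ HarmonicOn3 φ U ∧
      ∀ x ∈ U \ ({0} : Set (EuclideanSpace ℝ (Fin 3))), Φ x = c / ‖x‖ + φ x := by
  obtain ⟨R, hR, hRU⟩ := Metric.nhds_basis_closedBall.mem_iff.1 (hU.mem_nhds h0)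
  let η : ContDiffBump (0 : E3) := ⟨R / 2, R, by positivity, by linarith⟩
  obtain ⟨c, ψ, hψ, hΦψ⟩ := hΦharm.exists_eq_inv_norm_add hU hΦnonneg η hRU
  have hr : 0 < η.rIn / 2 := half_pos η.rIn_pos
  have hball : ∀ x : E3, ‖x‖ < η.rIn / 2 → x ∈ U := fun x hx =>
    hRU (by simp only [mem_closedBall_zero_iff, η] at hx ⊢; linarith)
  have hc : 0 ≤ c := nonneg_of_nonneg_inv_norm_add hr hψ.continuous.continuousAt
    fun x hx hxr => hΦψ x hx hxr ▸ hΦnonneg x ⟨hball x hxr, hx⟩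
  let φ : E3 → ℝ := Function.update (fun x => Φ x - c * ‖x‖⁻¹) 0 (ψ 0)
  have hφ : ∀ x, x ≠ 0 → φ x = Φ x - c * ‖x‖⁻¹ := fun x hx => Function.update_of_ne hx _ _
  refine ⟨c, φ, hc, HarmonicOn3.of_contDiffAt_zero hU ?_ h0 ?_, fun x hx => ?_⟩
  · have hV : IsOpen (U \ {0}) := hU.sdiff isClosed_singleton
    have key : ∀ x ∈ U \ {0}, φ =ᶠ[𝓝 x] (fun x => Φ x - c * ‖x‖⁻¹) ∧ ContDiffAt ℝ 2 Φ x ∧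
        ContDiffAt ℝ 2 (fun x : E3 => ‖x‖⁻¹) x := fun x hx =>
      ⟨(isOpen_ne.eventually_mem hx.2).mono hφ, hΦharm.1.contDiffAt (hV.mem_nhds hx),
        contDiffAt_inv_norm hx.2⟩
    refine ⟨fun x hx => ?_, fun x hx => ?_⟩ <;> obtain ⟨he, h1, h2⟩ := key x hx
    · exact ((h1.sub (contDiffAt_const.mul h2)).congr_of_eventuallyEq he).contDiffWithinAt
    · rw [he.laplacian3, laplacian3_sub h1 (contDiffAt_const.mul h2), laplacian3_const_mul _ h2,
        hΦharm.2 x hx, laplacian3_inv_norm hx.2, mul_zero, sub_zero]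
  · refine hψ.contDiffAt.congr_of_eventuallyEq ?_
    filter_upwards [ball_mem_nhds (0 : E3) hr] with x hx
    rcases eq_or_ne x 0 with rfl | hx0
    · exact Function.update_self _ _ _
    · rw [hφ x hx0, hΦψ x hx0 (by simpa using hx)]
      ring
  · rw [hφ x hx.2, div_eq_mul_inv]
    ring
end

section
/- Let E ⊂ ℝ³ be a compact set and suppose there exists a finite nonnegative Borel measure μ on ℝ³ with support contained in E such that the Newtonian potential ψ(x) = ∫ |x − y|⁻¹ dμ(y) satisfies ψ(x) = +∞ for every x ∈ E and ψ(x) < +∞ for every x ∉ E. Let Ψ : ℝ³ ∖ E → ℝ be a nonnegative harmonic function. Then there is a constant K ≥ 0 such that Ψ(x) ≤ K + K / dist(x, E) for all x ∈ ℝ³ ∖ E, where dist denotes Euclidean distance. -/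
open scoped BigOperators

/-- The Newtonian potential of a measure `μ` on `ℝ³` (with values in `ℝ≥0∞`;
note `(ENNReal.ofReal 0)⁻¹ = ∞`, so the kernel is `+∞` on the diagonal). -/
noncomputable def newtonianPotential (μ : MeasureTheory.Measure (EuclideanSpace ℝ (Fin 3)))
    (x : EuclideanSpace ℝ (Fin 3)) : ENNReal :=
  ∫⁻ y, (ENNReal.ofReal ‖x - y‖)⁻¹ ∂μ

open MeasureTheory Metric Set Filter Topology

local notation "E3" => EuclideanSpace ℝ (Fin 3)

theorem hasDerivAt_max_zero_pow_three (s : ℝ) :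
    HasDerivAt (fun s : ℝ => (max 0 s) ^ 3) (3 * (max 0 s) ^ 2) s := by
  have h : (fun s : ℝ => (max 0 s) ^ 3) = fun s => (s ^ 3 + s ^ 2 * |s|) / 2 := by
    funext s
    rcases le_total 0 s with h | h
    · rw [max_eq_right h, abs_of_nonneg h]; ring
    · rw [max_eq_left h, abs_of_nonpos h]; ring
  rcases lt_trichotomy s 0 with h0 | rfl | h0
  · rw [max_eq_left h0.le]
    refine HasDerivAt.congr_of_eventuallyEq (f := fun _ => 0) ?_ ?_
    · simpa using hasDerivAt_const s (0:ℝ)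
    · filter_upwards [gt_mem_nhds h0] with t ht
      simp [max_eq_left (le_of_lt ht)]
  · rw [hasDerivAt_iff_isLittleO_nhds_zero]
    have : (fun h : ℝ => h ^ 2) =o[𝓝 0] fun h => h := by
      simpa using Asymptotics.isLittleO_pow_id (𝕜 := ℝ) (n := 2) (by norm_num)
    refine Asymptotics.IsBigO.trans_isLittleO ?_ this
    refine Asymptotics.IsBigO.of_bound 1 ?_
    filter_upwards [Metric.ball_mem_nhds (0:ℝ) one_pos] with t ht
    have ht : |t| < 1 := by simpa using ht
    have ht2 := abs_lt.1 ht
    simp only [zero_add, max_self, smul_eq_mul, one_mul, Real.norm_eq_abs]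
    norm_num
    rcases le_total 0 t with h | h
    · rw [max_eq_right h, abs_of_nonneg h]; nlinarith [sq_nonneg t]
    · rw [max_eq_left h]; simp; positivity
  · rw [max_eq_right h0.le]
    refine HasDerivAt.congr_of_eventuallyEq (f := fun s => s ^ 3) ?_ ?_
    · simpa using hasDerivAt_pow 3 s
    · filter_upwards [lt_mem_nhds h0] with t ht
      simp [max_eq_right (le_of_lt ht)]

theorem harmonicOn3_inv_norm_sub (p : E3) : HarmonicOn3 (fun x => ‖x - p‖⁻¹) {p}ᶜ := by
  have hne : ∀ x ∈ ({p}ᶜ : Set E3), ‖x - p‖ ≠ 0 := fun x hx => by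
    simpa [sub_eq_zero] using hx
  have hd : ∀ x ∈ ({p}ᶜ : Set E3),
      HasFDerivAt (fun x => ‖x - p‖) (‖x - p‖⁻¹ • innerSL ℝ (x - p)) x := by
    intro x hx
    have h1 : HasFDerivAt (fun x : E3 => ‖x - p‖ ^ 2) (2 • innerSL ℝ (x - p)) x := by
      simpa using ((hasFDerivAt_id x).sub_const p).norm_sq
    have h2 := h1.sqrt (by simpa using pow_ne_zero 2 (hne x hx))
    simp only [Real.sqrt_sq (norm_nonneg _)] at h2
    have := hne x hx
    refine h2.congr_fderiv ?_
    ext w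
    simp only [smul_apply, innerSL_apply_apply, smul_eq_mul, nsmul_eq_mul]
    field_simp
    push_cast
    ring
  have hd1 : ∀ x ∈ ({p}ᶜ : Set E3), ∀ v : E3,
      fderiv ℝ (fun x => ‖x - p‖⁻¹) x v = - (inner ℝ (x - p) v * (‖x - p‖ ^ 3)⁻¹) := by
    intro x hx v
    have := ((hasDerivAt_inv (hne x hx)).comp_hasFDerivAt x (hd x hx)).fderiv
    simp only [Function.comp_def] at this
    rw [this]
    have := hne x hx
    simp only [smul_apply, innerSL_apply_apply, smul_eq_mul]
    field_simp
  have hU : IsOpen ({p}ᶜ : Set E3) := isOpen_compl_singleton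
  refine ⟨?_, fun x hx => ?_⟩
  · refine ContDiffOn.inv ?_ hne
    exact ContDiffOn.norm ℝ (by fun_prop) (fun x hx => by simpa [sub_eq_zero] using hx)
  · have h2 : ∀ v : E3, fderiv ℝ (fun y => fderiv ℝ (fun x => ‖x - p‖⁻¹) y v) x v =
        - (‖v‖ ^ 2 * (‖x - p‖ ^ 3)⁻¹) + 3 * (inner ℝ (x - p) v) ^ 2 * (‖x - p‖ ^ 5)⁻¹ := by
      intro v
      have he : (fun y => fderiv ℝ (fun x => ‖x - p‖⁻¹) y v) =ᶠ[𝓝 x]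
          fun y => - (inner ℝ (y - p) v * (‖y - p‖ ^ 3)⁻¹) := by
        filter_upwards [hU.mem_nhds hx] with y hy using hd1 y hy v
      rw [he.fderiv_eq]
      have ha : HasFDerivAt (fun y : E3 => inner ℝ (y - p) v) (innerSL ℝ v) x := by
        have := ((innerSL ℝ v).hasFDerivAt (x := x - p)).comp x ((hasFDerivAt_id x).sub_const p)
        simpa [Function.comp_def, real_inner_comm] using this
      have hb := (hasDerivAt_inv (pow_ne_zero 3 (hne x hx))).comp_hasFDerivAt x
        ((hd x hx).pow 3)
      have hc := (ha.mul hb).neg.fderiv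
      simp only [Function.comp_def, Pi.mul_def, Pi.neg_def] at hc
      erw [hc]
      have := hne x hx
      simp
      rw [inner_sub_left]
      field_simp
    unfold laplacian3
    simp only [h2]
    have hs : ∑ i : Fin 3, (inner ℝ (x - p) (EuclideanSpace.single i 1)) ^ 2 = ‖x - p‖ ^ 2 := by
      rw [EuclideanSpace.norm_sq_eq]
      simp [EuclideanSpace.inner_single_right]
    have := hne x hx
    rw [Finset.sum_add_distrib, ← Finset.sum_mul, ← Finset.mul_sum, hs]
    simp
    field_simp
    norm_num

theorem hasFDerivAt_max_one_sub_norm_sq_pow_three (z : E3) :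
    HasFDerivAt (fun z : E3 => (max 0 (1 - ‖z‖ ^ 2)) ^ 3)
      ((-6 * (max 0 (1 - ‖z‖ ^ 2)) ^ 2) • innerSL ℝ z) z := by
  have h1 : HasFDerivAt (fun z : E3 => 1 - ‖z‖ ^ 2) (-(2 • innerSL ℝ z)) z := by
    simpa using ((hasFDerivAt_id z).norm_sq).const_sub 1
  refine ((hasDerivAt_max_zero_pow_three (1 - ‖z‖ ^ 2)).comp_hasFDerivAt z h1).congr_fderiv ?_
  ext v
  simp
  ring

theorem clm_apply_eq_sum (L : E3 →L[ℝ] ℝ) (z : E3) :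
    L z = ∑ i : Fin 3, z i * L (EuclideanSpace.single i 1) := by
  conv_lhs => rw [← (EuclideanSpace.basisFun (Fin 3) ℝ).sum_repr z]
  simp

theorem integral_fderiv_apply_mul_eq_zero {f : E3 → ℝ} {U : Set E3} (hU : IsOpen U)
    (hf : HarmonicOn3 f U) {y : E3} {t : ℝ} (hB : ∀ z ∈ closedBall (0 : E3) 1, y + t • z ∈ U) :
    ∫ z in closedBall (0 : E3) 1, fderiv ℝ f (y + t • z) z * (1 - ‖z‖ ^ 2) ^ 2 = 0 := by
  obtain ⟨hC, hL⟩ := hf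
  set B := closedBall (0 : E3) 1 with hBdef
  have hBc : IsCompact B := isCompact_closedBall _ _
  have hC1 : ContDiffOn ℝ 1 (fderiv ℝ f) U :=
    ((contDiffOn_succ_iff_fderiv_of_isOpen (n := 1) hU).1 hC).2.2
  set e : Fin 3 → E3 := fun i => EuclideanSpace.single i 1 with he
  set g : Fin 3 → E3 → ℝ := fun i u => fderiv ℝ f u (e i) with hg
  have hgC : ∀ i, ContDiffOn ℝ 1 (g i) U := fun i => hC1.clm_apply contDiffOn_const
  have hgd : ∀ i, ∀ u ∈ U, HasFDerivAt (g i) (fderiv ℝ (g i) u) u := fun i u hu =>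
    (((hgC i).differentiableOn (by norm_num)).differentiableAt (hU.mem_nhds hu)).hasFDerivAt
  have hgc : ∀ i, ContinuousOn (fderiv ℝ (g i)) U := fun i =>
    (hgC i).continuousOn_fderiv_of_isOpen hU le_rfl
  have hmap : ContinuousOn (fun z : E3 => y + t • z) B := by fun_prop
  set D : Fin 3 → E3 → ℝ := fun i z =>
    t * fderiv ℝ (g i) (y + t • z) (e i) * (max 0 (1 - ‖z‖ ^ 2)) ^ 3
      + g i (y + t • z) * (-6 * (max 0 (1 - ‖z‖ ^ 2)) ^ 2 * z i) with hD
  have hmx : Continuous (fun z : E3 => max 0 (1 - ‖z‖ ^ 2)) :=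
    continuous_const.max (by fun_prop)
  have hout : ∀ z ∉ B, max 0 (1 - ‖z‖ ^ 2) = 0 := by
    intro z hz
    have : 1 < ‖z‖ := by simpa [hBdef] using hz
    exact max_eq_left (by nlinarith)
  have hG : ∀ i z, ∃ G' : E3 →L[ℝ] ℝ, HasFDerivAt
      (fun z => g i (y + t • z) * (max 0 (1 - ‖z‖ ^ 2)) ^ 3) G' z ∧ G' (e i) = D i z := by
    intro i z
    by_cases hz : z ∈ B
    · have h1 : HasFDerivAt (fun z : E3 => y + t • z) (t • ContinuousLinearMap.id ℝ E3) z :=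
        ((hasFDerivAt_id z).const_smul t).const_add y
      have h2 := ((hgd i _ (hB z hz)).comp z h1).mul (hasFDerivAt_max_one_sub_norm_sq_pow_three z)
      refine ⟨_, h2, ?_⟩
      simp [hD, he, EuclideanSpace.inner_single_right]
      ring
    · refine ⟨0, ?_, ?_⟩
      · refine (hasFDerivAt_const (0 : ℝ) z).congr_of_eventuallyEq ?_
        filter_upwards [isClosed_closedBall.isOpen_compl.mem_nhds hz] with u hu
        simp [hout u hu]
      · simp [hD, hout z hz]
  have hD0 : ∀ i, ∀ z ∉ B, D i z = 0 := fun i z hz => by simp [hD, hout z hz]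
  have hDc : ∀ i, ContinuousOn (D i) B := by
    intro i
    have h1 : ContinuousOn (fun z => fderiv ℝ (g i) (y + t • z) (e i)) B :=
      ((hgc i).comp hmap hB).clm_apply continuousOn_const
    have h2 : ContinuousOn (fun z => g i (y + t • z)) B :=
      (hgC i).continuousOn.comp hmap hB
    exact ((continuousOn_const.mul h1).mul (hmx.pow 3).continuousOn).add
      (h2.mul ((continuousOn_const.mul (hmx.pow 2).continuousOn).mul (by fun_prop)))
  have hDi : ∀ i, IntegrableOn (D i) B := fun i => (hDc i).integrableOn_compact hBc
  have hGi : ∀ i, Integrable (fun z => g i (y + t • z) * (max 0 (1 - ‖z‖ ^ 2)) ^ 3) := by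
    intro i
    refine IntegrableOn.integrable_of_forall_notMem_eq_zero (s := B) ?_
      (fun z hz => by simp [hout z hz])
    refine ContinuousOn.integrableOn_compact hBc ?_
    have h2 : ContinuousOn (fun z => g i (y + t • z)) B :=
      (hgC i).continuousOn.comp hmap hB
    exact h2.mul (hmx.pow 3).continuousOn
  have hDint : ∀ i, ∫ z in B, D i z = 0 := by
    intro i
    choose G' hG1 hG2 using hG i
    rw [setIntegral_eq_integral_of_forall_compl_eq_zero (hD0 i)]
    have hfd : ∀ z, fderiv ℝ (fun z => g i (y + t • z) * (max 0 (1 - ‖z‖ ^ 2)) ^ 3) z (e i)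
        = D i z := fun z => by rw [(hG1 z).fderiv, hG2]
    have := integral_mul_fderiv_eq_neg_fderiv_mul_of_integrable (μ := volume)
      (f := fun _ : E3 => (1 : ℝ))
      (g := fun z => g i (y + t • z) * (max 0 (1 - ‖z‖ ^ 2)) ^ 3) (v := e i)
      (by simp) (by
        simp only [hfd, one_mul]
        exact (hDi i).integrable_of_forall_notMem_eq_zero (hD0 i))
      (by simpa using hGi i) (fun _ _ => by fun_prop) (fun z _ => (hG1 z).differentiableAt)
    simpa [hfd] using this
  have hsum : ∫ z in B, ∑ i, D i z = 0 := by
    rw [integral_finsetSum _ (fun i _ => hDi i)]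
    simp [hDint]
  have heq : ∫ z in B, ∑ i, D i z =
      ∫ z in B, (-6) * (fderiv ℝ f (y + t • z) z * (1 - ‖z‖ ^ 2) ^ 2) := by
    refine setIntegral_congr_fun isClosed_closedBall.measurableSet (fun z hz => ?_)
    have hz1 : ‖z‖ ≤ 1 := by simpa [hBdef] using hz
    have hl : ∑ i, fderiv ℝ (g i) (y + t • z) (e i) = 0 := hL _ (hB z hz)
    have hm : max 0 (1 - ‖z‖ ^ 2) = 1 - ‖z‖ ^ 2 :=
      max_eq_right (by nlinarith [norm_nonneg z])
    have h1 : ∀ i, D i z = (t * (1 - ‖z‖ ^ 2) ^ 3) * fderiv ℝ (g i) (y + t • z) (e i)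
        + (-6 * (1 - ‖z‖ ^ 2) ^ 2) * (z i * fderiv ℝ f (y + t • z) (e i)) := by
      intro i
      simp only [hD, hm, hg]
      ring
    simp only [h1, Finset.sum_add_distrib, ← Finset.mul_sum, hl]
    rw [clm_apply_eq_sum _ z]
    ring
  rw [hsum, integral_const_mul] at heq
  linarith

theorem HarmonicOn3.mean_value {f : E3 → ℝ} {U : Set E3} (hU : IsOpen U)
    (hf : HarmonicOn3 f U) {y : E3} {r : ℝ} (hr : 0 ≤ r) (hB : closedBall y r ⊆ U) :
    ∫ z in closedBall (0 : E3) 1, f (y + r • z) * (1 - ‖z‖ ^ 2) ^ 2 =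
      f y * ∫ z in closedBall (0 : E3) 1, (1 - ‖z‖ ^ 2) ^ 2 := by
  obtain ⟨δ, hδ, hδU⟩ := (isCompact_closedBall y r).exists_cthickening_subset_open hU hB
  rw [cthickening_closedBall hδ.le hr] at hδU
  have hBc : IsCompact (closedBall (0 : E3) 1) := isCompact_closedBall _ _
  have hmem : ∀ t ∈ Ioo (-(δ + r)) (δ + r), ∀ z ∈ closedBall (0 : E3) 1,
      y + t • z ∈ closedBall y (δ + r) := by
    intro t ht z hz
    have hz1 : ‖z‖ ≤ 1 := by simpa using hz
    have ht1 : |t| ≤ δ + r := (abs_lt.2 ht).le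
    simp only [mem_closedBall, dist_self_add_left, norm_smul, Real.norm_eq_abs]
    nlinarith [abs_nonneg t, norm_nonneg z]
  have hfc := hf.1.continuousOn
  have hC1 : ContDiffOn ℝ 1 (fderiv ℝ f) U :=
    ((contDiffOn_succ_iff_fderiv_of_isOpen (n := 1) hU).1 hf.1).2.2
  obtain ⟨M, hM⟩ := (isCompact_closedBall y (δ + r)).exists_bound_of_continuousOn
    (hC1.continuousOn.mono hδU)
  have hder : ∀ t ∈ Ioo (-(δ + r)) (δ + r), HasDerivAt
      (fun t => ∫ z in closedBall (0 : E3) 1, f (y + t • z) * (1 - ‖z‖ ^ 2) ^ 2) 0 t := by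
    intro t ht
    have hmap : ∀ t : ℝ, ContinuousOn (fun z : E3 => y + t • z) (closedBall (0 : E3) 1) :=
      fun t => by fun_prop
    have hF : ∀ t ∈ Ioo (-(δ + r)) (δ + r), IntegrableOn
        (fun z => f (y + t • z) * (1 - ‖z‖ ^ 2) ^ 2) (closedBall (0 : E3) 1) := by
      intro t ht
      refine ContinuousOn.integrableOn_compact hBc ?_
      have := hfc.comp (hmap t) (fun z hz => hδU (hmem t ht z hz))
      exact this.mul (by fun_prop)
    rw [← integral_fderiv_apply_mul_eq_zero hU hf (fun z hz => hδU (hmem t ht z hz))]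
    refine (hasDerivAt_integral_of_dominated_loc_of_deriv_le
      (μ := volume.restrict (closedBall (0 : E3) 1))
      (F := fun t z => f (y + t • z) * (1 - ‖z‖ ^ 2) ^ 2)
      (F' := fun t z => fderiv ℝ f (y + t • z) z * (1 - ‖z‖ ^ 2) ^ 2)
      (bound := fun _ => M)
      (isOpen_Ioo.mem_nhds ht) ?_ (hF t ht) ?_ ?_ ?_ ?_).2
    · filter_upwards [isOpen_Ioo.mem_nhds ht] with s hs using (hF s hs).1
    · refine (ContinuousOn.integrableOn_compact hBc ?_).1
      have := hC1.continuousOn.comp (hmap t) (fun z hz => hδU (hmem t ht z hz))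
      exact (this.clm_apply continuousOn_id).mul (by fun_prop)
    · refine (ae_restrict_iff' isClosed_closedBall.measurableSet).2 (.of_forall ?_)
      intro z hz s hs
      have hz1 : ‖z‖ ≤ 1 := by simpa using hz
      have h1 := (fderiv ℝ f (y + s • z)).le_opNorm z
      have h2 := hM _ (hmem s hs z hz)
      have h3 : (1 - ‖z‖ ^ 2) ^ 2 ≤ 1 :=
        pow_le_one₀ (by nlinarith [norm_nonneg z]) (by nlinarith [norm_nonneg z])
      rw [norm_mul, Real.norm_eq_abs ((1 - ‖z‖ ^ 2) ^ 2), abs_of_nonneg (sq_nonneg _)]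
      calc _ ≤ M * 1 := by
            refine mul_le_mul (h1.trans ?_) h3 (sq_nonneg _) ((norm_nonneg _).trans h2)
            nlinarith [norm_nonneg z, norm_nonneg (fderiv ℝ f (y + s • z))]
        _ = M := mul_one M
    · exact integrableOn_const (hs := hBc.measure_lt_top.ne)
    · refine (ae_restrict_iff' isClosed_closedBall.measurableSet).2 (.of_forall ?_)
      intro z hz s hs
      have hd := ((hf.1.differentiableOn (by norm_num)).differentiableAt
        (hU.mem_nhds (hδU (hmem s hs z hz)))).hasFDerivAt
      have hl : HasDerivAt (fun s : ℝ => y + s • z) z s := by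
        simpa using ((hasDerivAt_id s).smul_const z).const_add y
      exact (hd.comp_hasDerivAt s hl).mul_const _
  have := isOpen_Ioo.is_const_of_deriv_eq_zero isPreconnected_Ioo
    (fun t ht => (hder t ht).differentiableAt.differentiableWithinAt)
    (fun t ht => (hder t ht).deriv) (x := r) (y := 0) ⟨by linarith, by linarith⟩
    ⟨by linarith, by linarith⟩
  rw [this]
  simp [integral_const_mul]

theorem add_smul_mem_closedBall (p : E3) {s : ℝ} (hs : 0 ≤ s) {z : E3}
    (hz : z ∈ closedBall (0 : E3) 1) : p + s • z ∈ closedBall p s := by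
  have hz1 : ‖z‖ ≤ 1 := by simpa using hz
  simp only [mem_closedBall, dist_self_add_left, norm_smul, Real.norm_eq_abs, abs_of_nonneg hs]
  nlinarith

theorem setIntegral_one_sub_norm_sq_pos :
    0 < ∫ z in closedBall (0 : E3) 1, (1 - ‖z‖ ^ 2) ^ 2 := by
  have hc : Continuous fun z : E3 => (1 - ‖z‖ ^ 2) ^ 2 := by fun_prop
  rw [setIntegral_pos_iff_support_of_nonneg_ae (.of_forall fun z => sq_nonneg _)
    (hc.continuousOn.integrableOn_compact (isCompact_closedBall _ _))]
  refine (measure_ball_pos volume (0 : E3) one_pos).trans_le (measure_mono fun z hz => ?_)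
  have : ‖z‖ < 1 := by simpa using hz
  refine ⟨?_, ball_subset_closedBall hz⟩
  have : 0 < 1 - ‖z‖ ^ 2 := by nlinarith [norm_nonneg z]
  exact (pow_pos this 2).ne'

theorem HarmonicOn3.harnack {f : E3 → ℝ} {U : Set E3} (hU : IsOpen U)
    (hf : HarmonicOn3 f U) (hf0 : ∀ x ∈ U, 0 ≤ f x) {x y : E3} {ρ : ℝ} (hρ : 0 < ρ)
    (hB : closedBall x (4 * ρ) ⊆ U) (hxy : dist y x ≤ ρ) : f x ≤ 88 * f y := by
  have hxU : closedBall x ρ ⊆ U := (closedBall_subset_closedBall (by linarith)).trans hB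
  have hyU : closedBall y (3 * ρ) ⊆ U :=
    (closedBall_subset_closedBall' (by linarith)).trans hB
  have hmx := hf.mean_value hU hρ.le hxU
  have hmy := hf.mean_value hU (by linarith) hyU
  have hpos := setIntegral_one_sub_norm_sq_pos
  set c := ∫ z in closedBall (0 : E3) 1, (1 - ‖z‖ ^ 2) ^ 2
  have hmem : ∀ (p : E3) (s : ℝ), 0 ≤ s → ∀ z ∈ closedBall (0 : E3) 1,
      p + s • z ∈ closedBall p s := fun p s hs z hz => add_smul_mem_closedBall p hs hz
  have hcont : ∀ (p : E3) (s : ℝ), 0 ≤ s → closedBall p s ⊆ U →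
      ContinuousOn (fun z => f (p + s • z)) (closedBall (0 : E3) 1) := by
    intro p s hs hp
    exact hf.1.continuousOn.comp (by fun_prop) (fun z hz => hp (hmem p s hs z hz))
  have hBc : IsCompact (closedBall (0 : E3) 1) := isCompact_closedBall _ _
  have hsub : closedBall (0 : E3) (2 / 3) ⊆ closedBall 0 1 :=
    closedBall_subset_closedBall (by norm_num)
  set H : E3 → ℝ := indicator (closedBall (0 : E3) (2 / 3)) (fun u => f (y + (3 * ρ) • u)) with hH
  have hH0 : ∀ u, 0 ≤ H u := fun u => indicator_nonneg
    (fun u hu => hf0 _ (hyU (hmem y _ (by linarith) u (hsub hu)))) u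
  have hHi : Integrable H := by
    rw [hH, integrable_indicator_iff isClosed_closedBall.measurableSet]
    exact ((hcont y _ (by linarith) hyU).integrableOn_compact hBc).mono_set hsub
  have hw : ∀ z ∈ closedBall (0 : E3) 1, (1 - ‖z‖ ^ 2) ^ 2 ≤ 1 := by
    intro z hz
    have hz1 : ‖z‖ ≤ 1 := by simpa using hz
    exact pow_le_one₀ (by nlinarith [norm_nonneg z]) (by nlinarith [norm_nonneg z])
  set a : E3 := (3 * ρ)⁻¹ • (x - y) with ha
  have h1 : f x * c ≤ ∫ z, H (a + (1 / 3 : ℝ) • z) := by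
    rw [← hmx, ← integral_indicator isClosed_closedBall.measurableSet]
    refine integral_mono_of_nonneg (.of_forall ?_) ?_ (.of_forall ?_)
    · exact fun z => indicator_nonneg
        (fun z hz => mul_nonneg (hf0 _ (hxU (hmem x ρ hρ.le z hz))) (sq_nonneg _)) z
    · exact (hHi.comp_add_left a).comp_smul (R := (1 / 3 : ℝ)) (by norm_num)
    · intro z
      by_cases hz : z ∈ closedBall (0 : E3) 1
      · have hz1 : ‖z‖ ≤ 1 := by simpa using hz
        have ha1 : ‖a‖ ≤ 1 / 3 := by
          rw [ha, norm_smul, ← dist_eq_norm, norm_inv, Real.norm_eq_abs,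
            abs_of_pos (by linarith), dist_comm, inv_mul_le_iff₀ (by linarith)]
          linarith
        have hin : a + (1 / 3 : ℝ) • z ∈ closedBall (0 : E3) (2 / 3) := by
          rw [mem_closedBall_zero_iff]
          refine (norm_add_le _ _).trans ?_
          have : ‖(1 / 3 : ℝ) • z‖ = 1 / 3 * ‖z‖ := by rw [norm_smul]; norm_num
          linarith
        have heq : y + (3 * ρ) • (a + (1 / 3 : ℝ) • z) = x + ρ • z := by
          rw [ha, smul_add, smul_smul, smul_smul, mul_inv_cancel₀ (by linarith), one_smul,
            show 3 * ρ * (1 / 3) = ρ by ring]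
          abel
        simp only [hH, indicator_of_mem hz, indicator_of_mem hin, heq]
        exact mul_le_of_le_one_right (hf0 _ (hxU (hmem x ρ hρ.le z hz))) (hw z hz)
      · simp only [indicator_of_notMem hz]
        exact hH0 _
  have h2 : ∫ z, H (a + (1 / 3 : ℝ) • z) = 27 * ∫ u, H u := by
    rw [Measure.integral_comp_smul volume (fun u => H (a + u)), integral_add_left_eq_self]
    simp
    norm_num
  have h3 : 25 / 81 * ∫ u, H u ≤ f y * c := by
    rw [← hmy, ← integral_indicator isClosed_closedBall.measurableSet, ← integral_const_mul]
    refine integral_mono_of_nonneg (.of_forall ?_) ?_ (.of_forall ?_)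
    · exact fun u => mul_nonneg (by norm_num) (hH0 u)
    · rw [integrable_indicator_iff isClosed_closedBall.measurableSet]
      exact ((hcont y _ (by linarith) hyU).mul (by fun_prop)).integrableOn_compact hBc
    · intro z
      by_cases hz : z ∈ closedBall (0 : E3) (2 / 3)
      · have hz1 : ‖z‖ ≤ 2 / 3 := by simpa using hz
        simp only [hH, indicator_of_mem hz, indicator_of_mem (hsub hz)]
        rw [mul_comm]
        refine mul_le_mul_of_nonneg_left ?_
          (hf0 _ (hyU (hmem y _ (by linarith) z (hsub hz))))
        have : 5 / 9 ≤ 1 - ‖z‖ ^ 2 := by nlinarith [norm_nonneg z]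
        nlinarith
      · simp only [hH, indicator_of_notMem hz, mul_zero]
        exact indicator_nonneg (fun z hz => mul_nonneg
          (hf0 _ (hyU (hmem y _ (by linarith) z hz))) (sq_nonneg _)) z
  have hy0 : 0 ≤ f y := hf0 y (hyU (mem_closedBall_self (by linarith)))
  have : f x * c ≤ 88 * f y * c := by nlinarith [mul_nonneg hy0 hpos.le]
  exact le_of_mul_le_mul_right this hpos

theorem integral_norm_add_smul_sq_gt (a : E3) {r : ℝ} (hr : 0 < r) :
    ‖a‖ ^ 2 * ∫ z in closedBall (0 : E3) 1, (1 - ‖z‖ ^ 2) ^ 2 <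
      ∫ z in closedBall (0 : E3) 1, ‖a + r • z‖ ^ 2 * (1 - ‖z‖ ^ 2) ^ 2 := by
  have hi : ∀ {g : E3 → ℝ}, Continuous g → IntegrableOn g (closedBall (0 : E3) 1) := fun hg =>
    hg.continuousOn.integrableOn_compact (isCompact_closedBall _ _)
  have hodd : ∫ z in closedBall (0 : E3) 1, inner ℝ a z * (1 - ‖z‖ ^ 2) ^ 2 = 0 := by
    rw [← integral_indicator isClosed_closedBall.measurableSet]
    have h := integral_neg_eq_self ((closedBall (0 : E3) 1).indicator
      fun z => inner ℝ a z * (1 - ‖z‖ ^ 2) ^ 2) volume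
    have h' : ∀ z, (closedBall (0 : E3) 1).indicator
        (fun z => inner ℝ a z * (1 - ‖z‖ ^ 2) ^ 2) (-z) =
        - (closedBall (0 : E3) 1).indicator (fun z => inner ℝ a z * (1 - ‖z‖ ^ 2) ^ 2) z := by
      intro z
      by_cases hz : z ∈ closedBall (0 : E3) 1
      · rw [indicator_of_mem hz, indicator_of_mem (by simpa using hz)]
        simp
      · rw [indicator_of_notMem hz, indicator_of_notMem (by simpa using hz)]
        simp
    simp only [h', integral_neg] at h
    linarith
  have hpos : 0 < ∫ z in closedBall (0 : E3) 1, ‖z‖ ^ 2 * (1 - ‖z‖ ^ 2) ^ 2 := by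
    rw [setIntegral_pos_iff_support_of_nonneg_ae
      (.of_forall fun z => by positivity) (hi (by fun_prop))]
    refine (measure_ball_pos volume (EuclideanSpace.single 0 (1 / 2) : E3)
      (r := 1 / 2) (by norm_num)).trans_le (measure_mono fun z hz => ?_)
    have h1 : ‖z - EuclideanSpace.single 0 (1 / 2)‖ < 1 / 2 := by simpa [dist_eq_norm] using hz
    have h2 : ‖(EuclideanSpace.single 0 (1 / 2) : E3)‖ = 1 / 2 := by simp
    have h3 : ‖z‖ < 1 := by
      have := norm_sub_norm_le z (EuclideanSpace.single 0 (1 / 2))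
      linarith
    have h4 : 0 < ‖z‖ := by
      have := norm_sub_norm_le (EuclideanSpace.single 0 (1 / 2)) z
      rw [norm_sub_rev] at this
      linarith
    have h5 : 0 < 1 - ‖z‖ ^ 2 := by nlinarith
    exact ⟨(by positivity : 0 < ‖z‖ ^ 2 * (1 - ‖z‖ ^ 2) ^ 2).ne', by simpa using h3.le⟩
  have hexp : ∀ z : E3, ‖a + r • z‖ ^ 2 * (1 - ‖z‖ ^ 2) ^ 2 =
      ‖a‖ ^ 2 * (1 - ‖z‖ ^ 2) ^ 2 + (2 * r) * (inner ℝ a z * (1 - ‖z‖ ^ 2) ^ 2)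
        + r ^ 2 * (‖z‖ ^ 2 * (1 - ‖z‖ ^ 2) ^ 2) := by
    intro z
    rw [norm_add_sq_real, inner_smul_right, norm_smul, Real.norm_eq_abs, mul_pow, sq_abs]
    ring
  simp only [hexp]
  rw [integral_add (hi (by fun_prop)) (hi (by fun_prop)), integral_add (hi (by fun_prop))
    (hi (by fun_prop)), integral_const_mul, integral_const_mul, integral_const_mul, hodd]
  have := mul_pos (pow_pos hr 2) hpos
  linarith

/-- The real-valued Newtonian potential of `μ`; meaningful where the kernel is integrable. -/
noncomputable def realPotential (μ : Measure E3) (x : E3) : ℝ := ∫ p, ‖x - p‖⁻¹ ∂μ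

theorem exists_ball_forall_le_norm_sub {E : Set E3} (hE : IsClosed E) {x : E3} (hx : x ∉ E) :
    ∃ δ > 0, ∀ x' ∈ ball x δ, ∀ p ∈ E, δ ≤ ‖x' - p‖ := by
  obtain ⟨δ, hδ, h⟩ := Metric.isOpen_iff.1 hE.isOpen_compl x hx
  refine ⟨δ / 2, by positivity, fun x' hx' p hp => ?_⟩
  by_contra! hlt
  refine h (a := p) ?_ hp
  rw [mem_ball] at hx' ⊢
  have := dist_triangle p x' x
  rw [← dist_eq_norm, dist_comm] at hlt
  linarith

theorem exists_forall_le_norm_sub {E K : Set E3} (hE : IsClosed E) (hK : IsCompact K)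
    (hKE : K ⊆ Eᶜ) : ∃ δ > 0, ∀ x ∈ K, ∀ p ∈ E, δ ≤ ‖x - p‖ := by
  obtain ⟨δ, hδ, h⟩ := hK.exists_thickening_subset_open hE.isOpen_compl hKE
  refine ⟨δ, hδ, fun x hx p hp => ?_⟩
  by_contra! hlt
  refine h (mem_thickening_iff.2 ⟨x, hx, ?_⟩) hp
  rwa [dist_comm, dist_eq_norm]

theorem realPotential_nonneg (μ : Measure E3) (x : E3) : 0 ≤ realPotential μ x :=
  integral_nonneg fun p => by positivity

section Potential

variable {E : Set E3} {μ : Measure E3} [IsFiniteMeasure μ]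

theorem continuousOn_realPotential (hE : IsClosed E) (hsupp : ∀ᵐ p ∂μ, p ∈ E) :
    ContinuousOn (realPotential μ) Eᶜ := by
  intro x hx
  obtain ⟨δ, hδ, h⟩ := exists_ball_forall_le_norm_sub hE hx
  refine ContinuousAt.continuousWithinAt ?_
  refine continuousAt_of_dominated (bound := fun _ => δ⁻¹) (.of_forall fun x => ?_) ?_
    (integrable_const _) ?_
  · exact (measurable_const.sub measurable_id).norm.inv.aestronglyMeasurable
  · filter_upwards [ball_mem_nhds x hδ] with x' hx'
    filter_upwards [hsupp] with p hp
    rw [norm_inv, norm_norm]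
    exact inv_anti₀ hδ (h x' hx' p hp)
  · filter_upwards [hsupp] with p hp
    have : ‖x - p‖ ≠ 0 := (hδ.trans_le (h x (mem_ball_self hδ) p hp)).ne'
    exact ContinuousAt.inv₀ (by fun_prop) this

theorem newtonianPotential_eq_ofReal (hE : IsClosed E) (hsupp : ∀ᵐ p ∂μ, p ∈ E) {x : E3}
    (hx : x ∉ E) : newtonianPotential μ x = ENNReal.ofReal (realPotential μ x) := by
  obtain ⟨δ, hδ, h⟩ := exists_ball_forall_le_norm_sub hE hx
  have hi : Integrable (fun p => ‖x - p‖⁻¹) μ := by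
    refine Integrable.of_bound
      (measurable_const.sub measurable_id).norm.inv.aestronglyMeasurable δ⁻¹ ?_
    filter_upwards [hsupp] with p hp
    rw [norm_inv, norm_norm]
    exact inv_anti₀ hδ (h x (mem_ball_self hδ) p hp)
  rw [realPotential, ofReal_integral_eq_lintegral_ofReal hi (.of_forall fun p => by positivity)]
  refine lintegral_congr_ae ?_
  filter_upwards [hsupp] with p hp
  rw [ENNReal.ofReal_inv_of_pos (hδ.trans_le (h x (mem_ball_self hδ) p hp))]

theorem realPotential_mean_value (hE : IsClosed E) (hsupp : ∀ᵐ p ∂μ, p ∈ E) {y : E3} {r : ℝ}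
    (hr : 0 ≤ r) (hB : closedBall y r ⊆ Eᶜ) :
    ∫ z in closedBall (0 : E3) 1, realPotential μ (y + r • z) * (1 - ‖z‖ ^ 2) ^ 2 =
      realPotential μ y * ∫ z in closedBall (0 : E3) 1, (1 - ‖z‖ ^ 2) ^ 2 := by
  obtain ⟨δ, hδ, h⟩ := exists_forall_le_norm_sub hE (isCompact_closedBall y r) hB
  have hmem : ∀ z ∈ closedBall (0 : E3) 1, y + r • z ∈ closedBall y r :=
    fun z hz => add_smul_mem_closedBall y hr hz
  have hfin : IsFiniteMeasure (volume.restrict (closedBall (0 : E3) 1)) :=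
    ⟨by simp⟩
  have hint : Integrable (Function.uncurry fun (z p : E3) =>
      ‖y + r • z - p‖⁻¹ * (1 - ‖z‖ ^ 2) ^ 2)
      ((volume.restrict (closedBall (0 : E3) 1)).prod μ) := by
    refine Integrable.of_bound (C := δ⁻¹ * 1) ?_ ?_
    · refine Measurable.aestronglyMeasurable ?_
      refine Measurable.mul (Measurable.inv ?_) ?_
      · exact Continuous.measurable (by fun_prop)
      · exact Continuous.measurable (by fun_prop)
    · have h1 : ∀ᵐ q ∂((volume.restrict (closedBall (0 : E3) 1)).prod μ),
          q.1 ∈ closedBall (0 : E3) 1 :=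
        Measure.quasiMeasurePreserving_fst.ae (ae_restrict_mem isClosed_closedBall.measurableSet)
      have h2 : ∀ᵐ q ∂((volume.restrict (closedBall (0 : E3) 1)).prod μ), q.2 ∈ E :=
        Measure.quasiMeasurePreserving_snd.ae hsupp
      filter_upwards [h1, h2] with q hq1 hq2
      have hz1 : ‖q.1‖ ≤ 1 := by simpa using hq1
      simp only [Function.uncurry]
      rw [norm_mul, norm_inv, norm_norm, norm_pow, Real.norm_eq_abs, sq_abs]
      exact mul_le_mul (inv_anti₀ hδ (h _ (hmem _ hq1) _ hq2))
        (pow_le_one₀ (by nlinarith [norm_nonneg q.1]) (by nlinarith [norm_nonneg q.1]))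
        (sq_nonneg _) (inv_nonneg.2 hδ.le)
  simp only [realPotential, ← integral_mul_const]
  rw [integral_integral_swap hint]
  refine integral_congr_ae ?_
  filter_upwards [hsupp] with p hp
  rw [(harmonicOn3_inv_norm_sub p).mean_value isOpen_compl_singleton hr]
  intro u hu hup
  exact hB hu (by rwa [mem_singleton_iff.1 hup])

theorem isCompact_setOf_realPotential_le (hE : IsClosed E) (hsupp : ∀ᵐ p ∂μ, p ∈ E)
    (hpot : ∀ x ∈ E, newtonianPotential μ x = ⊤) {K : Set E3} (hK : IsCompact K) (M : ℝ) :
    IsCompact {x ∈ K | x ∉ E ∧ realPotential μ x ≤ M} := by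
  refine hK.of_isClosed_subset (IsSeqClosed.isClosed ?_) (fun x hx => hx.1)
  intro u x hu hux
  have hxE : x ∉ E := by
    intro hxE
    have hle : newtonianPotential μ x ≤ ENNReal.ofReal M := by
      have hlim : ∀ p, liminf (fun n => (ENNReal.ofReal ‖u n - p‖)⁻¹) atTop =
          (ENNReal.ofReal ‖x - p‖)⁻¹ := by
        intro p
        refine Tendsto.liminf_eq ?_
        exact tendsto_inv_iff.2
          (ENNReal.tendsto_ofReal ((hux.sub_const p).norm))
      have hf := lintegral_liminf_le (μ := μ) (u := atTop)
        (f := fun (n : ℕ) p => (ENNReal.ofReal ‖u n - p‖)⁻¹)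
        (fun n => (measurable_const.sub measurable_id).norm.ennreal_ofReal.inv)
      simp only [hlim] at hf
      refine hf.trans ?_
      refine (liminf_le_liminf (v := fun _ => ENNReal.ofReal M) (.of_forall fun n => ?_)).trans
        (by simp)
      have := newtonianPotential_eq_ofReal hE hsupp (hu n).2.1
      simp only [newtonianPotential] at this
      rw [this]
      exact ENNReal.ofReal_le_ofReal (hu n).2.2
    rw [hpot x hxE] at hle
    exact ENNReal.ofReal_ne_top (top_le_iff.1 hle)
  refine ⟨hK.isClosed.isSeqClosed (fun n => (hu n).1) hux, hxE, ?_⟩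
  have hc := (continuousOn_realPotential hE hsupp).continuousAt (hE.isOpen_compl.mem_nhds hxE)
  exact le_of_tendsto (hc.tendsto.comp hux) (.of_forall fun n => (hu n).2.2)

end Potential

section Comparison

variable {E : Set E3} {μ : Measure E3} [IsFiniteMeasure μ]

theorem HarmonicOn3.le_add_of_annulus (hE : IsClosed E) (hsupp : ∀ᵐ p ∂μ, p ∈ E)
    (hpot : ∀ x ∈ E, newtonianPotential μ x = ⊤) {f : E3 → ℝ} (hf : HarmonicOn3 f Eᶜ)
    (hf0 : ∀ x ∉ E, 0 ≤ f x) {x₀ : E3} {ρ R m : ℝ} (hρ : 0 < ρ) (hm : 0 ≤ m) (hR : 0 < R)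
    (hfm : ∀ y ∉ E, dist y x₀ = ρ → m ≤ f y) {ε δ : ℝ} (hε : 0 < ε) (hδ : 0 < δ) {y : E3}
    (hy : y ∉ E) (hρy : ρ ≤ ‖y - x₀‖) (hyR : ‖y - x₀‖ ≤ R) :
    m * ρ * (‖y - x₀‖⁻¹ - R⁻¹) ≤ f y + ε * realPotential μ y + δ * (R ^ 2 - ‖y - x₀‖ ^ 2) := by
  by_contra! hlt
  set v : E3 → ℝ := fun x => f x + ε * realPotential μ x - m * ρ * ‖x - x₀‖⁻¹
    - δ * ‖x - x₀‖ ^ 2 with hv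
  set b : ℝ := - (m * ρ * R⁻¹) - δ * R ^ 2 with hb
  have hvy : v y < b := by simp only [hv, hb]; linarith
  set K : Set E3 := {x | ρ ≤ ‖x - x₀‖ ∧ ‖x - x₀‖ ≤ R} with hK
  have hKc : IsCompact K := by
    refine (isCompact_closedBall x₀ R).of_isClosed_subset ?_ ?_
    · have hc : Continuous fun x : E3 => ‖x - x₀‖ := by fun_prop
      exact (isClosed_le continuous_const hc).inter (isClosed_le hc continuous_const)
    · intro x hx
      rw [mem_closedBall, dist_eq_norm]
      exact hx.2
  have hbound : ∀ x ∈ K, x ∉ E → v x < b → realPotential μ x ≤ m / ε := by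
    intro x hx hxE hvx
    rw [le_div_iff₀ hε]
    have h1 : m * ρ * ‖x - x₀‖⁻¹ ≤ m := by
      rw [mul_assoc]
      refine mul_le_of_le_one_right hm ?_
      rw [← div_eq_mul_inv]
      exact (div_le_one (hρ.trans_le hx.1)).2 hx.1
    have h2 : δ * ‖x - x₀‖ ^ 2 ≤ δ * R ^ 2 :=
      mul_le_mul_of_nonneg_left (pow_le_pow_left₀ (norm_nonneg _) hx.2 2) hδ.le
    have h3 : 0 ≤ m * ρ * R⁻¹ := by positivity
    have h4 := hf0 x hxE
    simp only [hv, hb] at hvx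
    linarith
  have hNc := isCompact_setOf_realPotential_le hE hsupp hpot hKc (m / ε)
  have hpc := continuousOn_realPotential hE hsupp
  have hvc : ContinuousOn v (Eᶜ ∩ {x₀}ᶜ) := by
    have h1 : ContinuousOn f (Eᶜ ∩ {x₀}ᶜ) := hf.1.continuousOn.mono inter_subset_left
    have h2 : ContinuousOn (realPotential μ) (Eᶜ ∩ {x₀}ᶜ) := hpc.mono inter_subset_left
    have h3 : ContinuousOn (fun x => ‖x - x₀‖⁻¹) (Eᶜ ∩ {x₀}ᶜ) :=
      (harmonicOn3_inv_norm_sub x₀).1.continuousOn.mono inter_subset_right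
    exact ((h1.add (continuousOn_const.mul h2)).sub (continuousOn_const.mul h3)).sub (by fun_prop)
  have hne : ∀ x, ρ ≤ ‖x - x₀‖ → x ∈ ({x₀}ᶜ : Set E3) := by
    rintro x hx rfl
    simp at hx
    linarith
  obtain ⟨x₁, ⟨hx₁K, hx₁E, -⟩, hmin⟩ := hNc.exists_isMinOn
    ⟨y, ⟨hρy, hyR⟩, hy, hbound y ⟨hρy, hyR⟩ hy hvy⟩
    (hvc.mono fun x hx => ⟨hx.2.1, hne x hx.1.1⟩)
  have hv₁ : v x₁ < b :=
    (hmin ⟨⟨hρy, hyR⟩, hy, hbound y ⟨hρy, hyR⟩ hy hvy⟩).trans_lt hvy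
  have hp₁ := realPotential_nonneg μ x₁
  have hρ₁ : ρ < ‖x₁ - x₀‖ := by
    refine lt_of_le_of_ne hx₁K.1 fun h => ?_
    have h1 := hfm x₁ hx₁E (by rw [dist_eq_norm, h])
    simp only [hv, hb, ← h] at hv₁
    have h2 : m * ρ * ρ⁻¹ = m := by field_simp
    have h3 : δ * ρ ^ 2 ≤ δ * R ^ 2 := by
      refine mul_le_mul_of_nonneg_left (pow_le_pow_left₀ hρ.le ?_ 2) hδ.le
      exact h.le.trans hx₁K.2
    have h4 : 0 ≤ m * ρ * R⁻¹ := by positivity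
    have h5 : 0 ≤ ε * realPotential μ x₁ := by positivity
    linarith
  have hR₁ : ‖x₁ - x₀‖ < R := by
    refine lt_of_le_of_ne hx₁K.2 fun h => ?_
    have h1 := hf0 x₁ hx₁E
    have h5 : 0 ≤ ε * realPotential μ x₁ := by positivity
    simp only [hv, hb, h] at hv₁
    linarith
  have hO : IsOpen (Eᶜ ∩ {x | ρ < ‖x - x₀‖ ∧ ‖x - x₀‖ < R}) := by
    have hc : Continuous fun x : E3 => ‖x - x₀‖ := by fun_prop
    exact hE.isOpen_compl.inter
      ((isOpen_lt continuous_const hc).inter (isOpen_lt hc continuous_const))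
  obtain ⟨r, hr, hrO⟩ := Metric.nhds_basis_closedBall.mem_iff.1
    (hO.mem_nhds ⟨hx₁E, hρ₁, hR₁⟩)
  have hge : ∀ x ∈ closedBall x₁ r, v x₁ ≤ v x := by
    intro x hx
    obtain ⟨hxE, h1, h2⟩ := hrO hx
    by_cases hxb : v x < b
    · exact hmin ⟨⟨h1.le, h2.le⟩, hxE, hbound x ⟨h1.le, h2.le⟩ hxE hxb⟩
    · exact hv₁.le.trans (not_lt.1 hxb)
  have hmem : ∀ z ∈ closedBall (0 : E3) 1, x₁ + r • z ∈ closedBall x₁ r :=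
    fun z hz => add_smul_mem_closedBall x₁ hr.le hz
  have hBE : closedBall x₁ r ⊆ Eᶜ := hrO.trans inter_subset_left
  have hBx : closedBall x₁ r ⊆ {x₀}ᶜ := fun x hx => hne x (hrO hx).2.1.le
  have hBc : IsCompact (closedBall (0 : E3) 1) := isCompact_closedBall _ _
  have hi : ∀ {g : E3 → ℝ}, ContinuousOn g (closedBall x₁ r) → IntegrableOn
      (fun z => g (x₁ + r • z) * (1 - ‖z‖ ^ 2) ^ 2) (closedBall (0 : E3) 1) := fun hg =>
    ((hg.comp (by fun_prop) hmem).mul (by fun_prop)).integrableOn_compact hBc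
  have if1 := hi (hf.1.continuousOn.mono hBE)
  have if2 := hi (hpc.mono hBE)
  have if3 := hi ((harmonicOn3_inv_norm_sub x₀).1.continuousOn.mono hBx)
  have if4 := hi (g := fun x => ‖x - x₀‖ ^ 2) (by fun_prop)
  have e1 := hf.mean_value hE.isOpen_compl hr.le hBE
  have e2 := realPotential_mean_value hE hsupp hr.le hBE
  have e3 := (harmonicOn3_inv_norm_sub x₀).mean_value isOpen_compl_singleton hr.le hBx
  have e4 := integral_norm_add_smul_sq_gt (x₁ - x₀) hr
  have e4' : ∀ z : E3, x₁ - x₀ + r • z = x₁ + r • z - x₀ := fun z => by abel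
  simp only [e4'] at e4
  set c := ∫ z in closedBall (0 : E3) 1, (1 - ‖z‖ ^ 2) ^ 2 with hc
  have hlow : v x₁ * c ≤ ∫ z in closedBall (0 : E3) 1, v (x₁ + r • z) * (1 - ‖z‖ ^ 2) ^ 2 := by
    rw [hc, ← integral_const_mul]
    refine setIntegral_mono_on ?_ (hi (hvc.mono (subset_inter hBE hBx)))
      isClosed_closedBall.measurableSet ?_
    · exact ContinuousOn.integrableOn_compact hBc (by fun_prop)
    · exact fun z hz => mul_le_mul_of_nonneg_right (hge _ (hmem z hz)) (sq_nonneg _)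
  have hval : ∫ z in closedBall (0 : E3) 1, v (x₁ + r • z) * (1 - ‖z‖ ^ 2) ^ 2 =
      f x₁ * c + ε * (realPotential μ x₁ * c) - m * ρ * (‖x₁ - x₀‖⁻¹ * c)
        - δ * ∫ z in closedBall (0 : E3) 1, ‖x₁ + r • z - x₀‖ ^ 2 * (1 - ‖z‖ ^ 2) ^ 2 := by
    have s1 : IntegrableOn (fun z => f (x₁ + r • z) * (1 - ‖z‖ ^ 2) ^ 2
        + ε * (realPotential μ (x₁ + r • z) * (1 - ‖z‖ ^ 2) ^ 2)) (closedBall (0 : E3) 1) :=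
      if1.add (if2.const_mul ε)
    have s2 : IntegrableOn (fun z => f (x₁ + r • z) * (1 - ‖z‖ ^ 2) ^ 2
        + ε * (realPotential μ (x₁ + r • z) * (1 - ‖z‖ ^ 2) ^ 2)
        - m * ρ * (‖x₁ + r • z - x₀‖⁻¹ * (1 - ‖z‖ ^ 2) ^ 2)) (closedBall (0 : E3) 1) :=
      s1.sub (if3.const_mul _)
    rw [← e1, ← e2, ← e3, ← integral_const_mul, ← integral_const_mul, ← integral_const_mul,
      ← integral_add if1 (if2.const_mul ε),
      ← integral_sub s1 (if3.const_mul _), ← integral_sub s2 (if4.const_mul _)]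
    refine integral_congr_ae (.of_forall fun z => ?_)
    simp only [hv]
    ring
  rw [hval] at hlow
  have e5 := mul_lt_mul_of_pos_left e4 hδ
  simp only [hv] at hlow
  linarith

theorem HarmonicOn3.mul_inv_norm_le (hE : IsClosed E) (hsupp : ∀ᵐ p ∂μ, p ∈ E)
    (hpot : ∀ x ∈ E, newtonianPotential μ x = ⊤) {f : E3 → ℝ} (hf : HarmonicOn3 f Eᶜ)
    (hf0 : ∀ x ∉ E, 0 ≤ f x) {x₀ : E3} {ρ m : ℝ} (hρ : 0 < ρ) (hm : 0 ≤ m)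
    (hfm : ∀ y ∉ E, dist y x₀ = ρ → m ≤ f y) {y : E3} (hy : y ∉ E) (hρy : ρ ≤ ‖y - x₀‖) :
    m * ρ * ‖y - x₀‖⁻¹ ≤ f y := by
  have hR : ∀ᶠ R in atTop, m * ρ * (‖y - x₀‖⁻¹ - R⁻¹) ≤ f y := by
    filter_upwards [eventually_ge_atTop ‖y - x₀‖, eventually_gt_atTop 0] with R hyR hR
    have hlim : Tendsto (fun s : ℝ => f y + s * realPotential μ y
        + s * (R ^ 2 - ‖y - x₀‖ ^ 2)) (𝓝[>] 0) (𝓝 (f y)) := by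
      have : Continuous fun s : ℝ => f y + s * realPotential μ y
        + s * (R ^ 2 - ‖y - x₀‖ ^ 2) := by fun_prop
      simpa using (this.tendsto 0).mono_left nhdsWithin_le_nhds
    refine ge_of_tendsto hlim ?_
    filter_upwards [self_mem_nhdsWithin] with s hs
    exact hf.le_add_of_annulus hE hsupp hpot hf0 hρ hm hR hfm hs hs hy hρy hyR
  have hlim : Tendsto (fun R : ℝ => m * ρ * (‖y - x₀‖⁻¹ - R⁻¹)) atTop
      (𝓝 (m * ρ * (‖y - x₀‖⁻¹ - 0))) :=
    (tendsto_const_nhds.sub tendsto_inv_atTop_zero).const_mul _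
  rw [sub_zero] at hlim
  exact le_of_tendsto hlim hR

theorem HarmonicOn3.mul_le_of_closedBall_subset (hE : IsClosed E) (hsupp : ∀ᵐ p ∂μ, p ∈ E)
    (hpot : ∀ x ∈ E, newtonianPotential μ x = ⊤) {f : E3 → ℝ} (hf : HarmonicOn3 f Eᶜ)
    (hf0 : ∀ x ∉ E, 0 ≤ f x) {x y : E3} {ρ : ℝ} (hρ : 0 < ρ) (hB : closedBall x (4 * ρ) ⊆ Eᶜ)
    (hy : y ∉ E) : ρ * f x ≤ 88 * f y * (ρ + ‖y - x‖) := by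
  have hharnack : ∀ u, dist u x ≤ ρ → f x ≤ 88 * f u := fun u hu =>
    hf.harnack hE.isOpen_compl hf0 hρ hB hu
  have hfx : 0 ≤ f x := hf0 x (hB (mem_closedBall_self (by linarith)))
  have hfy := hf0 y hy
  rcases le_total ‖y - x‖ ρ with h | h
  · have := hharnack y (by rwa [dist_eq_norm])
    nlinarith [mul_nonneg hfy (norm_nonneg (y - x))]
  · have h1 := hf.mul_inv_norm_le hE hsupp hpot hf0 (x₀ := x) (m := f x / 88) hρ (by positivity)
      (fun u _ hu => by linarith [hharnack u hu.le]) hy h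
    have hpos : 0 < ‖y - x‖ := hρ.trans_le h
    rw [← div_eq_mul_inv, div_le_iff₀ hpos] at h1
    nlinarith [mul_nonneg hfy hρ.le]

end Comparison

/-- If `E ⊂ ℝ³` is compact of Newtonian capacity zero (polarity expressed via a
defining measure whose potential is infinite exactly on `E`), then every
nonnegative harmonic function `Ψ` on `ℝ³ ∖ E` satisfies
`Ψ(x) ≤ K + K / dist(x,E)`. -/
theorem harmonic_bound_polar_set
    (E : Set (EuclideanSpace ℝ (Fin 3))) (hE : IsCompact E)
    (μ : MeasureTheory.Measure (EuclideanSpace ℝ (Fin 3))) [MeasureTheory.IsFiniteMeasure μ]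
    (hsupp : μ Eᶜ = 0)
    (hpotE : ∀ x ∈ E, newtonianPotential μ x = ⊤)
    (hpotE' : ∀ x ∉ E, newtonianPotential μ x < ⊤)
    (Ψ : EuclideanSpace ℝ (Fin 3) → ℝ)
    (hΨharm : HarmonicOn3 Ψ Eᶜ)
    (hΨnonneg : ∀ x ∉ E, 0 ≤ Ψ x) :
    ∃ K : ℝ, 0 ≤ K ∧ ∀ x ∉ E, Ψ x ≤ K + K / Metric.infDist x E := by
  have hsupp' : ∀ᵐ p ∂μ, p ∈ E := by rwa [ae_iff]
  have hEc := hE.isClosed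
  obtain ⟨y, hy⟩ : Eᶜ.Nonempty := by
    rw [nonempty_compl]
    rintro rfl
    exact noncompact_univ (EuclideanSpace ℝ (Fin 3)) hE
  have hfy := hΨnonneg y hy
  have key : ∀ x ρ, 0 < ρ → closedBall x (4 * ρ) ⊆ Eᶜ →
      ρ * Ψ x ≤ 88 * Ψ y * (ρ + ‖y - x‖) := fun x ρ hρ hB =>
    hΨharm.mul_le_of_closedBall_subset hEc hsupp' hpotE hΨnonneg hρ hB hy
  rcases E.eq_empty_or_nonempty with rfl | hne
  · refine ⟨176 * Ψ y, by positivity, fun x _ => ?_⟩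
    have h := key x (1 + ‖y - x‖) (by positivity) (by simp)
    have h1 : 0 ≤ 176 * Ψ y / infDist x (∅ : Set (EuclideanSpace ℝ (Fin 3))) :=
      div_nonneg (by positivity) infDist_nonneg
    have h2 : 0 < 1 + ‖y - x‖ := by positivity
    have h3 : (1 + ‖y - x‖) * Ψ x ≤ (1 + ‖y - x‖) * (176 * Ψ y) := by nlinarith
    linarith [le_of_mul_le_mul_left h3 h2]
  · obtain ⟨D, hD⟩ : ∃ D, ∀ p ∈ E, ‖y - p‖ ≤ D := by
      obtain ⟨D, hD⟩ := hE.isBounded.subset_closedBall y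
      exact ⟨D, fun p hp => by rw [← dist_eq_norm, dist_comm]; exact hD hp⟩
    have hD0 : 0 ≤ D := by
      obtain ⟨p, hp⟩ := hne
      exact (norm_nonneg _).trans (hD p hp)
    refine ⟨528 * Ψ y * (1 + D), by positivity, fun x hx => ?_⟩
    have hd : 0 < infDist x E := (hEc.notMem_iff_infDist_pos hne).1 hx
    obtain ⟨p, hp, hpd⟩ := hE.exists_infDist_eq_dist hne x
    have hyx : ‖y - x‖ ≤ D + infDist x E := by
      have := norm_sub_le_norm_sub_add_norm_sub y p x
      rw [hpd, dist_eq_norm, norm_sub_rev x p]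
      linarith [hD p hp]
    set d := infDist x E with hd'
    have h := key x (d / 5) (by positivity) (fun u hu huE => by
      have := infDist_le_dist_of_mem (x := x) huE
      rw [mem_closedBall, dist_comm] at hu
      linarith)
    rw [← sub_nonneg]
    have : 528 * Ψ y * (1 + D) + 528 * Ψ y * (1 + D) / d - Ψ x =
      (528 * Ψ y * (1 + D) * (d + 1) - d * Ψ x) / d := by field_simp
    rw [this]
    refine div_nonneg (sub_nonneg.2 ?_) hd.le
    have h4 : 88 * Ψ y * (d / 5 + ‖y - x‖) ≤ 88 * Ψ y * (d / 5 + (D + d)) := by gcongr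
    nlinarith [mul_nonneg hfy hD0, mul_nonneg hfy hd.le, mul_nonneg (mul_nonneg hfy hD0) hd.le]
end

section
/- For all c > 0 and δ > 0 there exists a smooth strictly decreasing function u : (0,∞) → (0,∞) such that: (i) u(r) = √(c/r) for all r ≥ δ; (ii) u(r) ≥ √(c/r) for all r > 0; (iii) u''(r) + (2/r) u'(r) ≤ 0 for all r > 0 (equivalently, the radial function x ↦ u(|x|) is superharmonic on ℝ³ ∖ {0}); and (iv) r·u(r) converges to a positive finite limit as r → 0⁺. -/
open scoped BigOperators

/-- Every `C^∞` function on `ℝ` has a `C^∞` antiderivative with a prescribed value at a point. -/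
lemma exists_contDiff_antiderivative {f : ℝ → ℝ} (hf : ContDiff ℝ (⊤ : ℕ∞) f) (a y : ℝ) :
    ∃ F : ℝ → ℝ, ContDiff ℝ (⊤ : ℕ∞) F ∧ (∀ t, HasDerivAt F (f t) t) ∧ F a = y := by
  have hF : ∀ t, HasDerivAt (fun t => y + ∫ s in a..t, f s) (f t) t := fun t =>
    (hf.continuous.integral_hasStrictDerivAt a t).hasDerivAt.const_add y
  refine ⟨fun t => y + ∫ s in a..t, f s, ?_, hF, by simp⟩
  rw [contDiff_infty_iff_deriv]
  refine ⟨fun t => (hF t).differentiableAt, ?_⟩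
  rwa [show deriv (fun t => y + ∫ s in a..t, f s) = f from funext fun t => (hF t).deriv]

lemma hasDerivAt_mul_sqrt (k : ℝ) {t : ℝ} (ht : 0 < t) :
    HasDerivAt (fun t => k * √t) (k / (2 * √t)) t := by
  refine ((Real.hasDerivAt_sqrt ht.ne').const_mul k).congr_deriv ?_
  ring

lemma hasDerivAt_div_two_mul_sqrt (k : ℝ) {t : ℝ} (ht : 0 < t) :
    HasDerivAt (fun t => k / (2 * √t)) (-(k / (4 * t * √t))) t := by
  have hs : 0 < √t := Real.sqrt_pos.2 ht
  refine ((((Real.hasDerivAt_sqrt ht.ne').const_mul 2).fun_inv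
    (by positivity)).const_mul k).congr_deriv ?_
  have h : t = √t ^ 2 := (Real.sq_sqrt ht.le).symm
  rw [show 4 * t * √t = 4 * √t ^ 2 * √t by rw [← h]]
  field_simp
  norm_num

/-- A smooth function on `ℝ` lying between the second derivative of `t ↦ k √t` and `0`, and equal
to that second derivative on `[δ, ∞)`. -/
lemma exists_contDiff_cutoff {k δ : ℝ} (hk : 0 ≤ k) (hδ : 0 < δ) :
    ∃ f : ℝ → ℝ, ContDiff ℝ (⊤ : ℕ∞) f ∧ (∀ t, 0 ≤ t → f t ≤ 0) ∧
      (∀ t, 0 < t → -(k / (4 * t * √t)) ≤ f t) ∧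
      (∀ t, δ ≤ t → f t = -(k / (4 * t * √t))) := by
  refine ⟨fun t => Real.smoothTransition ((2 * t - δ) / δ) * -(k / (4 * t * √t)),
    ?_, ?_, ?_, ?_⟩
  · rw [contDiff_iff_contDiffAt]
    intro t
    rcases lt_or_ge 0 t with ht | ht
    · have hs : ContDiffAt ℝ (⊤ : ℕ∞) Real.sqrt t := Real.contDiffAt_sqrt ht.ne'
      have h₁ : ContDiffAt ℝ (⊤ : ℕ∞) (fun t => Real.smoothTransition ((2 * t - δ) / δ)) t :=
        Real.smoothTransition.contDiffAt.comp t (by fun_prop)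
      have hs' : 0 < √t := Real.sqrt_pos.2 ht
      refine h₁.mul (ContDiffAt.neg (contDiffAt_const.div ?_ (by positivity)))
      exact (contDiffAt_const.mul contDiffAt_id).mul hs
    · refine (contDiffAt_const (c := (0 : ℝ))).congr_of_eventuallyEq ?_
      filter_upwards [Iio_mem_nhds (show t < δ / 2 by linarith)] with s hs
      rw [Real.smoothTransition.zero_of_nonpos, zero_mul]
      refine div_nonpos_of_nonpos_of_nonneg ?_ hδ.le
      linarith [Set.mem_Iio.1 hs]
  · intro t ht
    exact mul_nonpos_of_nonneg_of_nonpos (Real.smoothTransition.nonneg _)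
      (neg_nonpos.2 (by positivity))
  · intro t ht
    have h : 0 ≤ k / (4 * t * √t) := by positivity
    nlinarith [Real.smoothTransition.le_one ((2 * t - δ) / δ)]
  · intro t ht
    dsimp only
    rw [Real.smoothTransition.one_of_one_le, one_mul]
    rw [le_div_iff₀ hδ]
    linarith

/-- A function with derivative zero on `[a, ∞)` is constant there. -/
lemma eq_of_hasDerivAt_zero_of_le {F : ℝ → ℝ} {a : ℝ} (h : ∀ t, a ≤ t → HasDerivAt F 0 t)
    {t : ℝ} (ht : a ≤ t) : F t = F a :=
  constant_of_has_deriv_right_zero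
    (fun s hs => (h s hs.1).continuousAt.continuousWithinAt)
    (fun s hs => (h s hs.1).hasDerivWithinAt) t ⟨ht, le_rfl⟩

lemma antitoneOn_of_hasDerivAt_nonpos {D : Set ℝ} (hD : Convex ℝ D) {F F' : ℝ → ℝ}
    (h : ∀ t ∈ D, HasDerivAt F (F' t) t) (h' : ∀ t ∈ D, F' t ≤ 0) : AntitoneOn F D :=
  antitoneOn_of_hasDerivWithinAt_nonpos hD
    (fun t ht => (h t ht).continuousAt.continuousWithinAt)
    (fun t ht => (h t (interior_subset ht)).hasDerivWithinAt)
    (fun t ht => h' t (interior_subset ht))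

/-- A smooth concave function `w` on `[0, ∞)`, positive at `0`, lying above `k √t` and equal to it
on `[δ, ∞)`. -/
lemma exists_concave_extension_mul_sqrt {k δ : ℝ} (hk : 0 < k) (hδ : 0 < δ) :
    ∃ w w' w'' : ℝ → ℝ, ContDiff ℝ (⊤ : ℕ∞) w ∧ (∀ t, HasDerivAt w (w' t) t) ∧
      (∀ t, HasDerivAt w' (w'' t) t) ∧ (∀ t, 0 ≤ t → w'' t ≤ 0) ∧ 0 < w 0 ∧
      (∀ t, 0 < t → k * √t ≤ w t) ∧ (∀ t, δ ≤ t → w t = k * √t) := by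
  obtain ⟨f, hf, hf_nonpos, hf_ge, hf_eq⟩ := exists_contDiff_cutoff hk.le hδ
  obtain ⟨P, hP, hP', hPδ⟩ := exists_contDiff_antiderivative hf δ (k / (2 * √δ))
  obtain ⟨w, hw, hw', hwδ⟩ := exists_contDiff_antiderivative hP δ (k * √δ)
  have hd₁ : ∀ t, 0 < t → HasDerivAt (fun t => w t - k * √t) (P t - k / (2 * √t)) t :=
    fun t ht => (hw' t).sub (hasDerivAt_mul_sqrt k ht)
  have hd₂ : ∀ t, 0 < t → HasDerivAt (fun t => P t - k / (2 * √t))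
      (f t - -(k / (4 * t * √t))) t :=
    fun t ht => (hP' t).sub (hasDerivAt_div_two_mul_sqrt k ht)
  have hP_eq : ∀ t, δ ≤ t → P t - k / (2 * √t) = 0 := fun t ht => by
    have h := eq_of_hasDerivAt_zero_of_le (F := fun t => P t - k / (2 * √t)) (a := δ)
      (fun s hs => by simpa [hf_eq s hs] using hd₂ s (hδ.trans_le hs)) ht
    simpa [hPδ] using h
  have hw_eq : ∀ t, δ ≤ t → w t = k * √t := fun t ht => by
    have h := eq_of_hasDerivAt_zero_of_le (F := fun t => w t - k * √t) (a := δ)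
      (fun s hs => by simpa only [hP_eq s hs] using hd₁ s (hδ.trans_le hs)) ht
    exact sub_eq_zero.1 (by simpa [hwδ] using h)
  have hP_le : ∀ t ∈ Set.Ioc 0 δ, P t - k / (2 * √t) ≤ 0 := fun t ht => by
    have h := antitoneOn_of_hasDerivAt_nonpos (convex_Ioc 0 δ)
      (fun s hs => (hd₂ s hs.1).fun_neg) (fun s hs => by linarith [hf_ge s hs.1])
      ht (Set.right_mem_Ioc.2 hδ) ht.2
    linarith [hP_eq δ le_rfl]
  have hw_ge : ∀ t, 0 < t → k * √t ≤ w t := fun t ht => by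
    rcases le_total δ t with h | h
    · exact (hw_eq t h).ge
    · have := antitoneOn_of_hasDerivAt_nonpos (convex_Ioc 0 δ)
        (fun s hs => hd₁ s hs.1) hP_le ⟨ht, h⟩ (Set.right_mem_Ioc.2 hδ) h
      linarith [hw_eq δ le_rfl]
  have hP_le_zero : ∀ t, 0 ≤ t → P t ≤ P 0 := fun t ht =>
    antitoneOn_of_hasDerivAt_nonpos (convex_Ici 0) (fun s _ => hP' s) hf_nonpos
      Set.self_mem_Ici ht ht
  have hw_le : ∀ t, 0 ≤ t → w t ≤ w 0 + P 0 * t := fun t ht => by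
    have := antitoneOn_of_hasDerivAt_nonpos (convex_Ici 0)
      (fun s _ => (hw' s).fun_sub ((hasDerivAt_id' s).const_mul (P 0)))
      (fun s hs => by linarith [hP_le_zero s hs]) Set.self_mem_Ici ht ht
    simp only [mul_zero, sub_zero] at this
    linarith
  refine ⟨w, P, f, hw, hw', hP', hf_nonpos, ?_, hw_ge, hw_eq⟩
  by_contra! h0
  set s := k / (P 0 ^ 2 + k + 1) with hs_def
  have hs : 0 < s := by positivity
  have hden : 0 < P 0 ^ 2 + k + 1 := by positivity
  have hsk : s * (P 0 ^ 2 + k + 1) = k := by rw [hs_def]; field_simp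
  have h₁ := hw_ge (s ^ 2) (by positivity)
  rw [Real.sqrt_sq hs.le] at h₁
  have h₂ := hw_le (s ^ 2) (by positivity)
  have h₃ : k ≤ P 0 * s := le_of_mul_le_mul_right (by linarith : k * s ≤ P 0 * s * s) hs
  nlinarith [sq_nonneg (P 0 - 1), mul_pos hs hk]

/-- ODE construction from the proof of Proposition 6: a smooth strictly decreasing
positive function `u` on `(0,∞)` with `u(r) = √(c/r)` for `r ≥ δ`, `u ≥ √(c/r)`
everywhere, `u'' + (2/r)u' ≤ 0` (radial superharmonicity on `ℝ³ ∖ {0}`), and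
`r·u(r) → L > 0` as `r → 0⁺`. -/
theorem radial_superharmonic_interpolation (c δ : ℝ) (hc : 0 < c) (hδ : 0 < δ) :
    ∃ u : ℝ → ℝ,
      ContDiffOn ℝ (⊤ : ℕ∞) u (Set.Ioi (0 : ℝ)) ∧
      StrictAntiOn u (Set.Ioi (0 : ℝ)) ∧
      (∀ r : ℝ, 0 < r → 0 < u r) ∧
      (∀ r : ℝ, δ ≤ r → u r = Real.sqrt (c / r)) ∧
      (∀ r : ℝ, 0 < r → Real.sqrt (c / r) ≤ u r) ∧
      (∀ r : ℝ, 0 < r → deriv (deriv u) r + (2 / r) * deriv u r ≤ 0) ∧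
      ∃ L : ℝ, 0 < L ∧
        Filter.Tendsto (fun r => r * u r) (nhdsWithin 0 (Set.Ioi (0 : ℝ))) (nhds L) := by
  obtain ⟨w, w', w'', hw, hw', hw'', hw''_nonpos, hw0, hw_ge, hw_eq⟩ :=
    exists_concave_extension_mul_sqrt (Real.sqrt_pos.2 hc) hδ
  have hsqrt : ∀ r, 0 < r → √(c / r) = √c * √r / r := fun r hr => by
    rw [Real.sqrt_div hc.le, mul_div_assoc, Real.sqrt_div_self', mul_one_div]
  have hu' : ∀ r, 0 < r → HasDerivAt (fun r => w r / r) ((w' r * r - w r) / r ^ 2) r :=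
    fun r hr => by simpa using (hw' r).fun_div (hasDerivAt_id' r) hr.ne'
  have hu'_neg : ∀ r, 0 < r → (w' r * r - w r) / r ^ 2 < 0 := fun r hr => by
    refine div_neg_of_neg_of_pos ?_ (by positivity)
    have := antitoneOn_of_hasDerivAt_nonpos (convex_Ici 0)
      (fun s _ => ((hw'' s).fun_mul (hasDerivAt_id' s)).fun_sub (hw' s))
      (fun s hs => by
        nlinarith [mul_nonpos_of_nonpos_of_nonneg (hw''_nonpos s hs) (Set.mem_Ici.1 hs)])
      Set.self_mem_Ici hr.le hr.le
    simp only [mul_zero, zero_sub] at this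
    linarith
  refine ⟨fun r => w r / r, hw.contDiffOn.div contDiffOn_id fun r hr => ne_of_gt hr,
    ?_, ?_, ?_, ?_, ?_, w 0, hw0, ?_⟩
  · refine strictAntiOn_of_deriv_neg (convex_Ioi 0)
      (fun r hr => (hu' r hr).continuousAt.continuousWithinAt) fun r hr => ?_
    rw [interior_Ioi] at hr
    rw [(hu' r hr).deriv]
    exact hu'_neg r hr
  · intro r hr
    have hr' := Real.sqrt_pos.2 hr
    have hc' := Real.sqrt_pos.2 hc
    exact div_pos ((by positivity : 0 < √c * √r).trans_le (hw_ge r hr)) hr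
  · intro r hr
    simp only [hsqrt r (hδ.trans_le hr), hw_eq r hr]
  · intro r hr
    rw [hsqrt r hr]
    exact div_le_div_of_nonneg_right (hw_ge r hr) hr.le
  · intro r hr
    have heq : deriv (fun r => w r / r) =ᶠ[nhds r] fun r => (w' r * r - w r) / r ^ 2 := by
      filter_upwards [Ioi_mem_nhds hr] with s hs using (hu' s hs).deriv
    have hu'' := (((hw'' r).fun_mul (hasDerivAt_id' r)).fun_sub (hw' r)).fun_div
      (hasDerivAt_pow 2 r) (by positivity)
    rw [heq.deriv_eq, hu''.deriv, (hu' r hr).deriv]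
    refine le_of_eq_of_le ?_ (div_nonpos_of_nonpos_of_nonneg (hw''_nonpos r hr.le) hr.le)
    field_simp
    norm_num
    ring
  · refine (hw.continuous.continuousAt.tendsto.mono_left nhdsWithin_le_nhds).congr' ?_
    filter_upwards [self_mem_nhdsWithin] with r hr
    exact (mul_div_cancel₀ _ (ne_of_gt hr)).symm
end
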